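/- arXiv:2101.04052 — 9 statements merged into one kernel-verified Lean document; each statement's English description precedes it below -/
import Mathlib

section
/- Let P(x,y,z) be a homogeneous polynomial with real coefficients in three variables. Then (x+z)² divides P(x,y,z) in ℝ[x,y,z] if and only if the one-variable polynomial P(−1,y,1) is identically zero and the one-variable polynomial (∂P/∂x)(−1,y,1) is identically zero. -/
open MvPolynomial

/-- Substituting `x ↦ -z` does not change a polynomial modulo `x + z`. -/
theorem X_add_X_dvd_sub_bind₁ (P : MvPolynomial (Fin 3) ℝ) :
    (X 0 + X 2 : MvPolynomial (Fin 3) ℝ) ∣ P - bind₁ ![-X 2, X 1, X 2] P := by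
  induction P using MvPolynomial.induction_on with
  | C a => simp
  | add p q hp hq => simpa [add_sub_add_comm] using dvd_add hp hq
  | mul_X p i hp =>
    have hi : (X 0 + X 2 : MvPolynomial (Fin 3) ℝ) ∣
        X i - (![-X 2, X 1, X 2] : Fin 3 → MvPolynomial (Fin 3) ℝ) i := by
      fin_cases i <;> simp
    rw [map_mul, bind₁_X_right]
    exact dvd_mul_sub_mul hp hi

theorem eval_smul_of_isHomogeneous {σ R : Type*} [CommSemiring R] {d : ℕ}
    {P : MvPolynomial σ R} (hP : P.IsHomogeneous d) (c : R) (v : σ → R) :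
    eval (c • v) P = c ^ d * eval v P := by
  rw [eval_eq, eval_eq, Finset.mul_sum]
  refine Finset.sum_congr rfl fun m hm => ?_
  have hd : ∑ i ∈ m.support, m i = d :=
    (Finsupp.degree_apply m).symm.trans
      (Finsupp.degree_eq_weight_one (R := ℕ) ▸ hP (mem_support_iff.mp hm))
  simp only [Pi.smul_apply, smul_eq_mul, mul_pow, Finset.prod_mul_distrib]
  rw [Finset.prod_pow_eq_pow_sum, hd]
  ring

/-- A homogeneous polynomial vanishing at all points `(-1, y, 1)` is divisible by `x + z`. -/
theorem X_add_X_dvd_of_eval_eq_zero {d : ℕ}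
    {P : MvPolynomial (Fin 3) ℝ} (hP : P.IsHomogeneous d)
    (h : ∀ y : ℝ, eval ![-1, y, 1] P = 0) :
    (X 0 + X 2 : MvPolynomial (Fin 3) ℝ) ∣ P := by
  have hmul : X 2 * bind₁ (![-X 2, X 1, X 2] : Fin 3 → MvPolynomial (Fin 3) ℝ) P = 0 := by
    refine MvPolynomial.funext fun v => ?_
    rw [map_mul, eval_X, map_zero, mul_eq_zero, or_iff_not_imp_left]
    intro hv
    have hpt : (fun i => eval v ((![-X 2, X 1, X 2] : Fin 3 → MvPolynomial (Fin 3) ℝ) i)) =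
        v 2 • ![-1, v 1 / v 2, 1] := by
      ext i
      fin_cases i <;> simp [mul_div_cancel₀, hv]
    have hev : eval v (bind₁ (![-X 2, X 1, X 2] : Fin 3 → MvPolynomial (Fin 3) ℝ) P) =
        eval (v 2 • ![-1, v 1 / v 2, 1]) P := by
      rw [← hpt]
      exact eval₂Hom_bind₁ _ _ _ _
    rw [hev, eval_smul_of_isHomogeneous hP, h, mul_zero]
  have hzero := (mul_eq_zero.mp hmul).resolve_left (X_ne_zero 2)
  simpa [hzero] using X_add_X_dvd_sub_bind₁ P

/-- Let `P(x,y,z)` be a homogeneous polynomial with real coefficients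
(`X 0 = x`, `X 1 = y`, `X 2 = z`). Then `(x+z)² ∣ P` in `ℝ[x,y,z]` iff the
one-variable polynomial `P(−1,y,1)` vanishes identically and the one-variable
polynomial `(∂P/∂x)(−1,y,1)` vanishes identically. -/
theorem sq_dvd_iff_vanishing (d : ℕ) (P : MvPolynomial (Fin 3) ℝ)
    (hP : P.IsHomogeneous d) :
    (X 0 + X 2 : MvPolynomial (Fin 3) ℝ) ^ 2 ∣ P ↔
      (∀ y : ℝ, eval ![-1, y, 1] P = 0) ∧
      (∀ y : ℝ, eval ![-1, y, 1] (pderiv 0 P) = 0) := by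
  constructor
  · rintro ⟨Q, rfl⟩
    constructor <;> intro y <;> simp
  · rintro ⟨h, h'⟩
    obtain ⟨R, rfl⟩ := X_add_X_dvd_of_eval_eq_zero hP h
    have hR := X_add_X_dvd_of_eval_eq_zero hP.pderiv h'
    have hL : pderiv 0 (X 0 + X 2 : MvPolynomial (Fin 3) ℝ) = 1 := by
      simp
    rw [pderiv_mul, hL, one_mul, dvd_add_left (dvd_mul_right _ _)] at hR
    rw [sq]
    exact mul_dvd_mul_left _ hR
end

section
/- For every integer q ≥ 1, the polynomial (x+z)² divides P_q(x,y,z) in ℝ[x,y,z]. -/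
open Finset MvPolynomial

/-- `a_q(l) = 1/(l!(q-l)!) · 1/(2l-1)`. -/
noncomputable def aCoeff (q l : ℕ) : ℝ :=
  (1 / ((l.factorial : ℝ) * ((q - l).factorial : ℝ))) * (1 / (2 * (l : ℝ) - 1))

/-- `b_q(l₁,l₂,n)`; all factorial arguments are non-negative in the admissible
range (we use truncated subtraction on `ℕ`). -/
noncomputable def bCoeff (q l₁ l₂ n : ℕ) : ℝ :=
  ((2 * q - 2 * l₁).factorial * (2 * l₁).factorial *
      (2 * q - 2 * l₂).factorial * (2 * l₂).factorial : ℝ) /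
    ((2 * q + n - 2 * l₁ - 2 * l₂).factorial * (2 * l₁ - n).factorial *
      (2 * l₂ - n).factorial * n.factorial : ℝ)

/-- `c_q = 2^{4q} (q!)² / (2q · (2q)!)`. -/
noncomputable def cCoeff (q : ℕ) : ℝ :=
  2 ^ (4 * q) * (q.factorial : ℝ) ^ 2 / (2 * (q : ℝ) * ((2 * q).factorial : ℝ))

/-- The polynomial `P̃_q ∈ ℝ[x,y,z]`, with variables `X 0 = x`, `X 1 = y`, `X 2 = z`. -/
noncomputable def PtildePoly (q : ℕ) : MvPolynomial (Fin 3) ℝ :=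
  ∑ l₁ ∈ range (q + 1), ∑ l₂ ∈ range (q + 1),
    ∑ n ∈ Finset.Icc (2 * (l₁ + l₂) - 2 * q) (min (2 * l₁) (2 * l₂)),
      C (aCoeff q l₁ * aCoeff q l₂ * bCoeff q l₁ l₂ n) *
        X 0 ^ (2 * q + n - 2 * l₁ - 2 * l₂) * X 1 ^ (2 * (l₁ + l₂) - 2 * n) * X 2 ^ n

/-- The polynomial `P_q = P̃_q + c_q(x^{2q-1}z + (2q-1)x^{2q-2}y²) ∈ ℝ[x,y,z]`. -/
noncomputable def Ppoly (q : ℕ) : MvPolynomial (Fin 3) ℝ :=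
  PtildePoly q +
    C (cCoeff q) * (X 0 ^ (2 * q - 1) * X 2 + C (2 * (q : ℝ) - 1) * X 0 ^ (2 * q - 2) * X 1 ^ 2)


/-- The half-spectrum part `∑_{b<q} (q-b) C(2q,b) (u+ιv)^{2q-b} (u-ιv)^b`. -/
def halfSum {A : Type*} [CommRing A] (q : ℕ) (ι u v : A) : A :=
  ∑ b ∈ range q, ((q : A) - b) * ((2 * q).choose b : A) * (u + ι * v) ^ (2 * q - b) *
    (u - ι * v) ^ b

/-- The even form `∑_l a_q(l) u^{2q-2l} v^{2l}`. -/
noncomputable def evenForm {A : Type*} [CommRing A] [Algebra ℂ A] (q : ℕ) (u v : A) : A :=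
  ∑ l ∈ range (q + 1), algebraMap ℂ A (aCoeff q l : ℂ) * u ^ (2 * q - 2 * l) * v ^ (2 * l)

lemma map_halfSum {A B : Type*} [CommRing A] [CommRing B] (f : A →+* B) (q : ℕ) (ι u v : A) :
    f (halfSum q ι u v) = halfSum q (f ι) (f u) (f v) := by
  simp [halfSum]

lemma map_evenForm {A B : Type*} [CommRing A] [Algebra ℂ A] [CommRing B] [Algebra ℂ B]
    (f : A →ₐ[ℂ] B) (q : ℕ) (u v : A) :
    f (evenForm q u v) = evenForm q (f u) (f v) := by
  simp [evenForm]

/-- Telescoping of the Euler-type operator `X d/dX - 1` along the partial sums of `halfSum`. -/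
lemma euler_partial_halfSum {q n : ℕ} (hn : n < q) (ι : ℂ) :
    ∑ b ∈ range (n + 1),
      ((q : Polynomial ℂ) - (b : Polynomial ℂ)) * ((2 * q).choose b : Polynomial ℂ) *
      (2 * (Polynomial.X * Polynomial.derivative
        ((1 + Polynomial.C ι * Polynomial.X) ^ (2 * q - b) *
          (1 - Polynomial.C ι * Polynomial.X) ^ b) -
        (1 + Polynomial.C ι * Polynomial.X) ^ (2 * q - b) *
          (1 - Polynomial.C ι * Polynomial.X) ^ b)) =
      ((n : Polynomial ℂ) + 1) * ((2 * q).choose (n + 1) : Polynomial ℂ) *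
        (((q : Polynomial ℂ) - (n : Polynomial ℂ) - 1) *
            (1 + Polynomial.C ι * Polynomial.X) ^ (2 * q - n) *
            (1 - Polynomial.C ι * Polynomial.X) ^ n -
          ((q : Polynomial ℂ) - (n : Polynomial ℂ)) *
            (1 + Polynomial.C ι * Polynomial.X) ^ (2 * q - n - 1) *
            (1 - Polynomial.C ι * Polynomial.X) ^ (n + 1)) := by
  set W : Polynomial ℂ := 1 + Polynomial.C ι * Polynomial.X with hW
  set V : Polynomial ℂ := 1 - Polynomial.C ι * Polynomial.X with hV
  have hdW : Polynomial.derivative W = Polynomial.C ι := by simp [hW]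
  have hdV : Polynomial.derivative V = -Polynomial.C ι := by simp [hV]
  have hX : 2 * (Polynomial.X * Polynomial.C ι) = W - V := by rw [hW, hV]; ring
  clear_value W V
  induction n with
  | zero =>
    obtain ⟨m, hm⟩ : ∃ m, 2 * q = m + 1 := ⟨2 * q - 1, by omega⟩
    have hmc : (2 * q : Polynomial ℂ) = m + 1 := by exact_mod_cast hm
    simp only [hm, zero_add, range_one, sum_singleton, Nat.sub_zero, pow_zero, mul_one,
      Polynomial.derivative_pow_succ, hdW, Nat.choose_zero_right, Nat.choose_one_right,
      Nat.add_sub_cancel, Polynomial.C_add, Polynomial.C_1, Polynomial.C_eq_natCast]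
    push_cast
    linear_combination (q * (m + 1) * W ^ m : Polynomial ℂ) * hX - (W ^ (m + 1) : Polynomial ℂ) * hmc
  | succ n ih =>
    rw [sum_range_succ, ih (by omega)]
    obtain ⟨m, hm⟩ : ∃ m, 2 * q = m + 2 + n := ⟨2 * q - 2 - n, by omega⟩
    have hmc : (2 * q : Polynomial ℂ) = m + 2 + n := by exact_mod_cast hm
    have hch : ((2 * q).choose (n + 1 + 1) : Polynomial ℂ) * (n + 2) =
        ((2 * q).choose (n + 1) : Polynomial ℂ) * (m + 1) := by
      have := Nat.choose_succ_right_eq (2 * q) (n + 1)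
      rw [show 2 * q - (n + 1) = m + 1 by omega] at this
      exact_mod_cast this
    rw [show 2 * q - (n + 1) - 1 = m by omega, show 2 * q - n - 1 = m + 1 by omega,
      show 2 * q - (n + 1) = m + 1 by omega, show 2 * q - n = m + 2 by omega,
      Polynomial.derivative_mul, Polynomial.derivative_pow_succ, Polynomial.derivative_pow_succ,
      hdW, hdV]
    push_cast
    simp only [map_natCast, map_add, map_one]
    generalize ((2 * q).choose (n + 1) : Polynomial ℂ) = c at *
    generalize ((2 * q).choose (n + 1 + 1) : Polynomial ℂ) = c' at *
    have hm' : (m : Polynomial ℂ) = 2 * q - 2 - n := by linear_combination -hmc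
    rw [hm'] at hch ⊢
    linear_combination (((q : Polynomial ℂ) - (n : Polynomial ℂ) - 1) * c *
      ((2 * q - 2 - n + 1) * W ^ m * V ^ (n + 1) -
      (n + 1) * W ^ (m + 1) * V ^ n)) * hX -
      ((q - (n + 1) - 1) * W ^ (m + 1) * V ^ (n + 1) - (q - (n + 1)) * W ^ m * V ^ (n + 1 + 1)) * hch

lemma euler_halfSum {q : ℕ} (hq : 1 ≤ q) {ι : ℂ} (hι : ι * ι = -1) :
    2 * (Polynomial.X * Polynomial.derivative (halfSum q (Polynomial.C ι) 1 Polynomial.X) -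
      halfSum q (Polynomial.C ι) 1 Polynomial.X) =
      -((q : Polynomial ℂ) * ((2 * q).choose q : Polynomial ℂ) * (1 + Polynomial.X ^ 2) ^ q) := by
  obtain ⟨n, rfl⟩ : ∃ n, q = n + 1 := ⟨q - 1, by omega⟩
  have h := euler_partial_halfSum (Nat.lt_succ_self n) ι
  have hc : Polynomial.C ι * Polynomial.C ι = (-1 : Polynomial ℂ) := by
    rw [← Polynomial.C_mul, hι]; simp
  have hprod : (1 + Polynomial.C ι * Polynomial.X) * (1 - Polynomial.C ι * Polynomial.X) =
      (1 + Polynomial.X ^ 2 : Polynomial ℂ) := by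
    linear_combination (-Polynomial.X ^ 2) * hc
  rw [← hprod, mul_pow]
  rw [show 2 * (n + 1) - n - 1 = n + 1 by omega] at h
  refine Eq.trans (Eq.trans ?_ h) ?_
  · rw [halfSum, Polynomial.derivative_sum, mul_sum, ← sum_sub_distrib, mul_sum]
    refine sum_congr rfl fun b _ => ?_
    rw [show ((n + 1 : ℕ) - b : Polynomial ℂ) * ((2 * (n + 1)).choose b : Polynomial ℂ) =
      Polynomial.C (((n + 1 : ℕ) - b : ℂ) * ((2 * (n + 1)).choose b : ℂ)) by simp, mul_assoc,
      Polynomial.derivative_C_mul]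
    ring
  · push_cast
    ring

lemma euler_evenForm (q : ℕ) :
    Polynomial.X * Polynomial.derivative (evenForm q 1 (Polynomial.X : Polynomial ℂ)) -
      evenForm q 1 Polynomial.X =
      Polynomial.C ((q.factorial : ℂ)⁻¹) * (1 + Polynomial.X ^ 2) ^ q := by
  rw [evenForm, Polynomial.derivative_sum, mul_sum, ← sum_sub_distrib,
    add_comm (1 : Polynomial ℂ), add_pow, mul_sum]
  refine sum_congr rfl fun l hl => ?_
  have hlq : l ≤ q := by simpa [Nat.lt_succ_iff] using hl
  have h1 : ((aCoeff q l : ℝ) : ℂ) * (2 * l - 1) = (q.factorial : ℂ)⁻¹ * (q.choose l : ℂ) := by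
    have h0 : (2 * (l : ℝ) - 1) ≠ 0 := by
      intro h
      have : (2 * (l : ℤ) - 1) = 0 := by exact_mod_cast h
      omega
    have : aCoeff q l * (2 * l - 1) = (q.factorial : ℝ)⁻¹ * (q.choose l : ℝ) := by
      rw [aCoeff, Nat.cast_choose ℝ hlq]
      have := q.factorial_ne_zero
      field_simp
    have h := congrArg Complex.ofReal this
    push_cast at h
    exact h
  have h2 : Polynomial.C ((aCoeff q l : ℝ) : ℂ) * (2 * l - 1) =
      Polynomial.C (q.factorial : ℂ)⁻¹ * (q.choose l : Polynomial ℂ) := by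
    have := congrArg Polynomial.C h1
    simpa [show Polynomial.C (2 : ℂ) = 2 from rfl] using this
  have h3 : (Polynomial.X : Polynomial ℂ) * Polynomial.derivative (Polynomial.X ^ (2 * l)) =
      2 * (l : Polynomial ℂ) * Polynomial.X ^ (2 * l) := by
    rcases l with _ | l
    · simp
    · rw [show 2 * (l + 1) = 2 * l + 1 + 1 by ring, Polynomial.derivative_X_pow_succ]
      push_cast
      simp [show Polynomial.C (2 : ℂ) = 2 from rfl]
      ring
  rw [one_pow, one_pow, mul_one, ← Polynomial.C_eq_algebraMap, Polynomial.derivative_C_mul]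
  rw [← pow_mul]
  linear_combination (Polynomial.X ^ (2 * l)) * h2 + Polynomial.C ((aCoeff q l : ℝ) : ℂ) * h3

lemma exists_eq_C_mul_X_of_euler {p : Polynomial ℂ}
    (h : Polynomial.X * Polynomial.derivative p = p) : ∃ c, p = Polynomial.C c * Polynomial.X := by
  refine ⟨p.coeff 1, ?_⟩
  ext n
  rw [Polynomial.coeff_C_mul_X]
  split_ifs with hn
  · rw [hn]
  · have := congrArg (fun r => r.coeff n) h
    rcases n with _ | n
    · simpa using this.symm
    · simp only [Polynomial.coeff_X_mul, Polynomial.coeff_derivative] at this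
      have hn' : (n : ℂ) ≠ 0 := by
        intro h0; apply hn; rw [Nat.cast_eq_zero.mp h0]
      have : p.coeff (n + 1) * n = 0 := by linear_combination this
      simpa [hn'] using this

/-- The constant relating `halfSum` to `evenForm`. -/
noncomputable def evenScale (q : ℕ) : ℂ := -(q * (2 * q).choose q * q.factorial / 2)

lemma halfSum_one_X {q : ℕ} (hq : 1 ≤ q) {ι : ℂ} (hι : ι * ι = -1) :
    halfSum q (Polynomial.C ι) 1 Polynomial.X =
      Polynomial.C (evenScale q) * evenForm q 1 Polynomial.X +
        Polynomial.C (ι * (q * 4 ^ q / 2)) * Polynomial.X := by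
  have hD : Polynomial.X * Polynomial.derivative (halfSum q (Polynomial.C ι) 1 Polynomial.X -
      Polynomial.C (evenScale q) * evenForm q 1 Polynomial.X) =
      halfSum q (Polynomial.C ι) 1 Polynomial.X -
      Polynomial.C (evenScale q) * evenForm q 1 Polynomial.X := by
    have h1 := euler_halfSum hq hι
    have h2 := euler_evenForm q
    have h3 : 2 * Polynomial.C (evenScale q) * Polynomial.C (q.factorial : ℂ)⁻¹ =
        -((q : Polynomial ℂ) * ((2 * q).choose q : Polynomial ℂ)) := by
      have : 2 * evenScale q * (q.factorial : ℂ)⁻¹ = -(q * (2 * q).choose q) := by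
        have : (q.factorial : ℂ) ≠ 0 := by exact_mod_cast q.factorial_ne_zero
        rw [evenScale]; field_simp
      have := congrArg Polynomial.C this
      simpa [show Polynomial.C (2 : ℂ) = 2 from rfl] using this
    rw [Polynomial.derivative_sub, Polynomial.derivative_C_mul]
    have h20 : (2 : Polynomial ℂ) ≠ 0 := two_ne_zero
    apply mul_left_cancel₀ h20
    linear_combination h1 - 2 * Polynomial.C (evenScale q) * h2 - (1 + Polynomial.X ^ 2) ^ q * h3
  obtain ⟨c, hc⟩ := exists_eq_C_mul_X_of_euler hD
  have hev (w : ℂ) : halfSum q ι 1 w = evenScale q * evenForm q 1 w + c * w := by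
    have h1 := map_halfSum (Polynomial.evalRingHom w) q (Polynomial.C ι) 1 Polynomial.X
    have h2 := map_evenForm (Polynomial.aeval w : Polynomial ℂ →ₐ[ℂ] ℂ) q 1 Polynomial.X
    have h3 := congrArg (Polynomial.eval w) hc
    simp at h1 h2 h3
    rw [h1, h2] at h3
    linear_combination h3
  have e1 := hev ι
  have e2 := hev (-ι)
  have heven : evenForm q 1 (-ι) = evenForm q 1 ι := by
    simp [evenForm, pow_mul]
  have v1 : halfSum q ι 1 ι = 0 := by
    refine sum_eq_zero fun b hb => ?_
    have : 2 * q - b ≠ 0 := by have := mem_range.mp hb; omega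
    rw [hι, add_neg_cancel, zero_pow this]; ring
  have v2 : halfSum q ι 1 (-ι) = q * 4 ^ q := by
    rw [halfSum, sum_eq_single_of_mem 0 (by simp; omega)]
    · rw [mul_neg, hι]
      norm_num [pow_mul]
    · intro b _ hb
      rw [mul_neg, hι]
      simp [hb]
  rw [v1] at e1
  rw [v2, heven] at e2
  have : c = ι * (q * 4 ^ q / 2) := by
    linear_combination (ι / 2) * (e1 - e2) + c * hι
  rw [← this]
  linear_combination hc

lemma halfSum_eq {A : Type*} [CommRing A] [Algebra ℂ A] {q : ℕ} (hq : 1 ≤ q) {ι : ℂ}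
    (hι : ι * ι = -1) (u v : A) :
    halfSum q (algebraMap ℂ A ι) u v = algebraMap ℂ A (evenScale q) * evenForm q u v +
      algebraMap ℂ A (ι * (q * 4 ^ q / 2)) * (u ^ (2 * q - 1) * v) := by
  have key (w : ℂ) : halfSum q ι 1 w = evenScale q * evenForm q 1 w +
      ι * (q * 4 ^ q / 2) * w := by
    have h1 := map_halfSum (Polynomial.evalRingHom w) q (Polynomial.C ι) 1 Polynomial.X
    have h2 := map_evenForm (Polynomial.aeval w : Polynomial ℂ →ₐ[ℂ] ℂ) q 1 Polynomial.X
    have h3 := congrArg (Polynomial.eval w) (halfSum_one_X hq hι)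
    simp at h1 h2 h3
    rw [h1, h2] at h3
    exact h3
  have hom (s w : ℂ) : halfSum q ι s (s * w) = s ^ (2 * q) * halfSum q ι 1 w := by
    rw [halfSum, halfSum, mul_sum]
    refine sum_congr rfl fun b hb => ?_
    have hb' : 2 * q = (2 * q - b) + b := by have := mem_range.mp hb; omega
    rw [show s + ι * (s * w) = s * (1 + ι * w) by ring,
      show s - ι * (s * w) = s * (1 - ι * w) by ring, mul_pow, mul_pow]
    rw [show s ^ (2 * q) = s ^ (2 * q - b) * s ^ b by rw [← pow_add, ← hb']]
    ring
  have hom' (s w : ℂ) : evenForm q s (s * w) = s ^ (2 * q) * evenForm q 1 w := by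
    rw [evenForm, evenForm, mul_sum]
    refine sum_congr rfl fun b hb => ?_
    have hb' : 2 * q = (2 * q - 2 * b) + 2 * b := by have := mem_range.mp hb; omega
    rw [mul_pow]
    rw [show s ^ (2 * q) = s ^ (2 * q - 2 * b) * s ^ (2 * b) by rw [← pow_add, ← hb']]
    ring
  have key2 (s w : ℂ) (hs : s ≠ 0) : halfSum q ι s w = evenScale q * evenForm q s w +
      ι * (q * 4 ^ q / 2) * (s ^ (2 * q - 1) * w) := by
    obtain ⟨w, rfl⟩ : ∃ w', w = s * w' := ⟨w / s, by field_simp⟩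
    rw [hom, hom', key]
    obtain ⟨m, hm⟩ : ∃ m, 2 * q = m + 1 := ⟨2 * q - 1, by omega⟩
    rw [hm, Nat.add_sub_cancel]
    ring
  have huniv : halfSum q (C ι) (X 0) (X 1 : MvPolynomial (Fin 2) ℂ) =
      C (evenScale q) * evenForm q (X 0) (X 1) +
      C (ι * (q * 4 ^ q / 2)) * (X 0 ^ (2 * q - 1) * X 1) := by
    apply mul_left_cancel₀ (X_ne_zero (R := ℂ) (0 : Fin 2))
    apply MvPolynomial.funext
    intro t
    have h1 := map_halfSum (MvPolynomial.eval t) q (C ι) (X 0) (X 1)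
    have h2 := map_evenForm (MvPolynomial.aeval t : MvPolynomial (Fin 2) ℂ →ₐ[ℂ] ℂ) q (X 0) (X 1)
    simp only [eval_C, eval_X] at h1
    simp only [aeval_eq_eval, eval_X] at h2
    rw [map_mul, map_mul, map_add, map_mul, map_mul, map_mul, h1, h2]
    simp only [eval_X]
    rcases eq_or_ne (t 0) 0 with h0 | h0
    · simp [h0]
    · rw [key2 _ _ h0]
      simp
  have := congrArg (MvPolynomial.aeval ![u, v] : MvPolynomial (Fin 2) ℂ →ₐ[ℂ] A) huniv
  have h1 := map_halfSum (MvPolynomial.aeval ![u, v] : MvPolynomial (Fin 2) ℂ →ₐ[ℂ] A).toRingHom q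
    (C ι) (X 0) (X 1)
  simp only [AlgHom.toRingHom_eq_coe, RingHom.coe_coe, algHom_C, aeval_X] at h1
  rw [h1, map_add, map_mul, map_mul, map_evenForm] at this
  simpa using this

/-- The apolar (Fischer) pairing on binary forms, for which `X i` is adjoint to `pderiv i`. -/
noncomputable def apolar (R : Type*) [CommRing R] :
    MvPolynomial (Fin 2) R →ₗ[R] MvPolynomial (Fin 2) R →ₗ[R] R :=
  (basisMonomials (Fin 2) R).constr R fun m =>
    (((m 0).factorial : R) * ((m 1).factorial : R)) • lcoeff R m

section Apolar

variable {R : Type*} [CommRing R]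

lemma apolar_monomial (m : Fin 2 →₀ ℕ) (a : R) (G : MvPolynomial (Fin 2) R) :
    apolar R (monomial m a) G =
      a * (((m 0).factorial : R) * ((m 1).factorial : R) * coeff m G) := by
  have h : monomial m a = a • (basisMonomials (Fin 2) R m) := by
    rw [coe_basisMonomials, smul_monomial, smul_eq_mul, mul_one]
  rw [h, map_smul, apolar, Module.Basis.constr_basis]
  simp [mul_assoc]

lemma apolar_mul_X (A G : MvPolynomial (Fin 2) R) (i : Fin 2) :
    apolar R (A * X i) G = apolar R A (pderiv i G) := by
  induction A using MvPolynomial.induction_on' with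
  | monomial m a =>
    rw [X, monomial_mul, mul_one, apolar_monomial, apolar_monomial, coeff_pderiv]
    fin_cases i <;> simp [Nat.factorial_succ] <;> ring
  | add p p' hp hp' => rw [add_mul, map_add, map_add, LinearMap.add_apply, LinearMap.add_apply,
      hp, hp']

lemma apolar_mul_linear (ι : R) (A G : MvPolynomial (Fin 2) R) :
    apolar R (A * (X 0 + C ι * X 1)) G =
      apolar R A ((pderiv 0 + ι • pderiv 1 : Derivation R _ _) G) := by
  have h : A * (X 0 + C ι * X 1) = A * X 0 + ι • (A * X 1) := by
    rw [smul_eq_C_mul]; ring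
  rw [h, map_add, map_smul, LinearMap.add_apply, LinearMap.smul_apply, apolar_mul_X, apolar_mul_X]
  simp

lemma pow_dvd_apolar {D : Derivation R (MvPolynomial (Fin 2) R) (MvPolynomial (Fin 2) R)}
    {W L₁ L₂ : MvPolynomial (Fin 2) R} {t s : R}
    (hW : ∀ A G, apolar R (A * W) G = apolar R A (D G)) (h₁ : D L₁ = C t) (h₂ : D L₂ = C s)
    (A : MvPolynomial (Fin 2) R) (a c d : ℕ) :
    s ^ (a - c) ∣ apolar R (A * W ^ a) (L₁ ^ c * L₂ ^ d) := by
  induction a generalizing c d with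
  | zero => simp
  | succ a ih =>
    rw [pow_succ W, ← mul_assoc, hW, D.leibniz, D.leibniz_pow, D.leibniz_pow, h₁, h₂]
    have e : L₁ ^ c • d • L₂ ^ (d - 1) • C s + L₂ ^ d • c • L₁ ^ (c - 1) • C t =
        ((d : R) * s) • (L₁ ^ c * L₂ ^ (d - 1)) + ((c : R) * t) • (L₁ ^ (c - 1) * L₂ ^ d) := by
      simp only [smul_eq_mul, nsmul_eq_mul, smul_eq_C_mul, map_mul, map_natCast]
      ring
    rw [e, map_add, map_smul, map_smul, smul_eq_mul, smul_eq_mul]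
    apply dvd_add
    · have h3 : s ^ (a + 1 - c) ∣ s * s ^ (a - c) := by
        rw [← pow_succ']
        exact pow_dvd_pow _ (by omega)
      refine h3.trans ?_
      rw [mul_assoc]
      exact (mul_dvd_mul_left s (ih c (d - 1))).mul_left _
    · rcases c with _ | c
      · simp
      · rw [Nat.add_sub_add_right, Nat.add_sub_cancel]
        exact (ih c d).mul_left _

lemma sq_dvd_apolar_halfSum (q : ℕ) {ι : R} (hι : ι * ι = -1) (x y z : R) :
    (x + z) ^ 2 ∣ apolar R (halfSum q (C ι) (X 0) (X 1))
      (halfSum q (C (-ι)) (C x * X 0 + C y * X 1) (C y * X 0 + C z * X 1)) := by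
  rw [halfSum, halfSum, map_sum]
  refine dvd_sum fun b' hb' => ?_
  rw [map_sum, LinearMap.sum_apply]
  refine dvd_sum fun b hb => ?_
  have hC : (C ι * C ι : MvPolynomial (Fin 2) R) = -1 := by rw [← C_mul, hι]; simp
  have hD₁ : (pderiv 0 + ι • pderiv 1 : Derivation R _ _)
      ((C x * X 0 + C y * X 1) + C ι * (C y * X 0 + C z * X 1) : MvPolynomial (Fin 2) R) =
      C (x - z + 2 * ι * y) := by
    simp [pderiv_X, smul_eq_C_mul, show (C (2 : R) : MvPolynomial (Fin 2) R) = 2 from rfl]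
    linear_combination C z * hC
  have hD₂ : (pderiv 0 + ι • pderiv 1 : Derivation R _ _)
      ((C x * X 0 + C y * X 1) + C (-ι) * (C y * X 0 + C z * X 1) : MvPolynomial (Fin 2) R) =
      C (x + z) := by
    simp [pderiv_X, smul_eq_C_mul]
    linear_combination -C z * hC
  have key := pow_dvd_apolar (apolar_mul_linear ι) hD₁ hD₂ ((X 0 - C ι * X 1) ^ b) (2 * q - b) b'
    (2 * q - b')
  have hbb : 2 ≤ 2 * q - b - b' := by
    have := mem_range.mp hb
    have := mem_range.mp hb'
    omega
  have e1 : ((q : MvPolynomial (Fin 2) R) - (b : MvPolynomial (Fin 2) R)) *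
      ((2 * q).choose b : MvPolynomial (Fin 2) R) *
      (X 0 + C ι * X 1) ^ (2 * q - b) * (X 0 - C ι * X 1) ^ b =
      (((q : R) - b) * ((2 * q).choose b : R)) •
        ((X 0 - C ι * X 1) ^ b * (X 0 + C ι * X 1) ^ (2 * q - b)) := by
    simp only [smul_eq_C_mul, map_mul, map_sub, map_natCast]
    ring
  have e2 (u v : MvPolynomial (Fin 2) R) :
      ((q : MvPolynomial (Fin 2) R) - (b' : MvPolynomial (Fin 2) R)) *
      ((2 * q).choose b' : MvPolynomial (Fin 2) R) *
      (u + C (-ι) * v) ^ (2 * q - b') * (u - C (-ι) * v) ^ b' =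
      (((q : R) - b') * ((2 * q).choose b' : R)) •
        ((u + C ι * v) ^ b' * (u + C (-ι) * v) ^ (2 * q - b')) := by
    rw [show u - C (-ι) * v = u + C ι * v by simp]
    simp only [smul_eq_C_mul, map_mul, map_sub, map_natCast]
    ring
  rw [e1, e2, map_smul, map_smul, LinearMap.smul_apply, smul_eq_mul, smul_eq_mul]
  exact (((pow_dvd_pow _ hbb).trans key).mul_left _).mul_left _

lemma apolar_X_pow {N i j : ℕ} (hi : i ≤ N) (hj : j ≤ N) (x y z : R) :
    apolar R (X 0 ^ (N - i) * X 1 ^ i)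
      ((C x * X 0 + C y * X 1) ^ (N - j) * (C y * X 0 + C z * X 1) ^ j) =
      ∑ n ∈ Icc (i + j - N) (min i j), ((N - i).factorial : R) * (i.factorial : R) *
        ((N - j).choose (i - n) : R) * (j.choose n : R) *
        (x ^ (N + n - i - j) * y ^ (i + j - 2 * n) * z ^ n) := by
  have hmon (a b : ℕ) : (X 0 ^ a * X 1 ^ b : MvPolynomial (Fin 2) R) =
      monomial (Finsupp.single 0 a + Finsupp.single 1 b) 1 := by
    rw [X_pow_eq_monomial, X_pow_eq_monomial, monomial_mul, mul_one]
  have hinj (a b c d : ℕ) : (Finsupp.single (0 : Fin 2) a + Finsupp.single 1 b =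
      Finsupp.single 0 c + Finsupp.single 1 d) ↔ a = c ∧ b = d := by
    constructor
    · intro h
      exact ⟨by simpa using DFunLike.congr_fun h 0, by simpa using DFunLike.congr_fun h 1⟩
    · rintro ⟨rfl, rfl⟩; rfl
  have hexp : (C x * X 0 + C y * X 1 : MvPolynomial (Fin 2) R) ^ (N - j) *
      (C y * X 0 + C z * X 1) ^ j =
      ∑ n ∈ range (j + 1), ∑ m ∈ range (N - j + 1),
        C (((N - j).choose m : R) * (j.choose n : R) *
          (x ^ (N - j - m) * y ^ (m + (j - n)) * z ^ n)) *
        (X 0 ^ (N - j - m + (j - n)) * X 1 ^ (m + n)) := by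
    rw [add_comm (C x * X 0), add_comm (C y * X 0), add_pow, add_pow, mul_comm, sum_mul_sum]
    refine sum_congr rfl fun n _ => sum_congr rfl fun m _ => ?_
    simp only [map_mul, map_pow, map_natCast, mul_pow, pow_add]
    ring
  rw [hexp, hmon, apolar_monomial, coeff_sum]
  have hinner (n : ℕ) (hn : n ∈ range (j + 1)) :
      coeff (Finsupp.single 0 (N - i) + Finsupp.single 1 i)
        (∑ m ∈ range (N - j + 1), C (((N - j).choose m : R) * (j.choose n : R) *
          (x ^ (N - j - m) * y ^ (m + (j - n)) * z ^ n)) *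
        (X 0 ^ (N - j - m + (j - n)) * X 1 ^ (m + n)) : MvPolynomial (Fin 2) R) =
      if n ∈ Icc (i + j - N) (min i j) then ((N - j).choose (i - n) : R) * (j.choose n : R) *
        (x ^ (N + n - i - j) * y ^ (i + j - 2 * n) * z ^ n) else 0 := by
    have hnj : n ≤ j := by simpa [Nat.lt_succ_iff] using hn
    rw [coeff_sum]
    simp only [coeff_C_mul, hmon, coeff_monomial, hinj, mul_ite, mul_one, mul_zero]
    split_ifs with hmem
    · rw [mem_Icc, le_min_iff] at hmem
      rw [sum_eq_single_of_mem (i - n) (by rw [mem_range]; omega)]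
      · rw [if_pos (by omega), show N - j - (i - n) = N + n - i - j by omega,
          show i - n + (j - n) = i + j - 2 * n by omega]
      · intro m _ hm
        rw [if_neg (by omega)]
    · refine sum_eq_zero fun m hm => ?_
      rw [mem_Icc, le_min_iff] at hmem
      rw [mem_range] at hm
      rw [if_neg (by omega)]
  rw [sum_congr rfl hinner, ← sum_filter, one_mul, mul_sum]
  have hf : (range (j + 1)).filter (· ∈ Icc (i + j - N) (min i j)) =
      Icc (i + j - N) (min i j) := by
    ext n
    simp only [mem_filter, mem_range, mem_Icc, le_min_iff]
    omega
  rw [hf]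
  refine sum_congr rfl fun n _ => ?_
  simp
  ring

lemma apolar_odd {N : ℕ} (hN : 2 ≤ N) (x y z : R) :
    apolar R (X 0 ^ (N - 1) * X 1)
      ((C x * X 0 + C y * X 1) ^ (N - 1) * (C y * X 0 + C z * X 1)) =
      ((N - 1).factorial : R) * (x ^ (N - 1) * z + ((N : R) - 1) * x ^ (N - 2) * y ^ 2) := by
  have h := apolar_X_pow (show 1 ≤ N by omega) (show 1 ≤ N by omega) x y z
  rw [show 1 + 1 - N = 0 by omega, min_self, ← Nat.range_succ_eq_Icc_zero, sum_range_succ,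
    sum_range_one] at h
  simp only [pow_one, Nat.add_zero, Nat.sub_zero, Nat.choose_one_right, Nat.choose_zero_right,
    Nat.choose_self, Nat.sub_self, Nat.factorial_one, pow_zero, Nat.cast_one, mul_one,
    mul_zero, Nat.reduceAdd, Nat.add_sub_cancel] at h
  rw [h, Nat.cast_sub (by omega : 1 ≤ N), Nat.sub_sub]
  push_cast
  ring

end Apolar


lemma apolar_evenForm (q : ℕ) :
    apolar (MvPolynomial (Fin 3) ℂ) (evenForm q (X 0) (X 1))
      (evenForm q (C (X 0) * X 0 + C (X 1) * X 1) (C (X 1) * X 0 + C (X 2) * X 1)) =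
      map Complex.ofRealHom (PtildePoly q) := by
  rw [evenForm, PtildePoly, map_sum, LinearMap.sum_apply, map_sum]
  refine sum_congr rfl fun l₁ h₁ => ?_
  rw [evenForm, map_sum, map_sum]
  refine sum_congr rfl fun l₂ h₂ => ?_
  rw [mem_range] at h₁ h₂
  have e (l : ℕ) (u v : MvPolynomial (Fin 2) (MvPolynomial (Fin 3) ℂ)) :
      algebraMap ℂ (MvPolynomial (Fin 2) (MvPolynomial (Fin 3) ℂ)) (aCoeff q l : ℂ) *
        u ^ (2 * q - 2 * l) * v ^ (2 * l) =
      (C (aCoeff q l : ℂ) : MvPolynomial (Fin 3) ℂ) • (u ^ (2 * q - 2 * l) * v ^ (2 * l)) := by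
    rw [smul_eq_C_mul, IsScalarTower.algebraMap_apply ℂ (MvPolynomial (Fin 3) ℂ),
      MvPolynomial.algebraMap_eq, MvPolynomial.algebraMap_eq, mul_assoc]
  rw [e, e, map_smul, map_smul, LinearMap.smul_apply,
    apolar_X_pow (by omega : 2 * l₁ ≤ 2 * q) (by omega : 2 * l₂ ≤ 2 * q), smul_eq_mul, smul_eq_mul,
    mul_sum, mul_sum, map_sum]
  rw [show 2 * l₁ + 2 * l₂ - 2 * q = 2 * (l₁ + l₂) - 2 * q by ring_nf]
  refine sum_congr rfl fun n hn => ?_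
  rw [mem_Icc, le_min_iff] at hn
  have hb : ((2 * q - 2 * l₁).factorial : ℝ) * ((2 * l₁).factorial : ℝ) *
      ((2 * q - 2 * l₂).choose (2 * l₁ - n) : ℝ) * ((2 * l₂).choose n : ℝ) =
      bCoeff q l₁ l₂ n := by
    rw [bCoeff, Nat.cast_choose ℝ (by omega : 2 * l₁ - n ≤ 2 * q - 2 * l₂),
      Nat.cast_choose ℝ hn.2.2,
      show 2 * q - 2 * l₂ - (2 * l₁ - n) = 2 * q + n - 2 * l₁ - 2 * l₂ by omega]
    have f1 := Nat.factorial_ne_zero (2 * q + n - 2 * l₁ - 2 * l₂)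
    have f2 := Nat.factorial_ne_zero (2 * l₁ - n)
    have f3 := Nat.factorial_ne_zero (2 * l₂ - n)
    have f4 := Nat.factorial_ne_zero n
    field_simp
  rw [← hb, show 2 * (l₁ + l₂) - 2 * n = 2 * l₁ + 2 * l₂ - 2 * n by rw [mul_add]]
  simp
  ring

lemma evenScale_sq_mul_cCoeff {q : ℕ} (hq : 1 ≤ q) :
    evenScale q ^ 2 * (cCoeff q : ℂ) =
      ((q : ℂ) * 4 ^ q / 2) ^ 2 * ((2 * q - 1).factorial : ℂ) := by
  have h1 : ((2 * q).factorial : ℂ) = 2 * q * ((2 * q - 1).factorial : ℂ) := by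
    have := Nat.mul_factorial_pred (by omega : 2 * q ≠ 0)
    exact_mod_cast this.symm
  have hq0 : (q : ℂ) ≠ 0 := by exact_mod_cast (by omega : q ≠ 0)
  have hf : (q.factorial : ℂ) ≠ 0 := by exact_mod_cast q.factorial_ne_zero
  have hg : ((2 * q - 1).factorial : ℂ) ≠ 0 := by exact_mod_cast (2 * q - 1).factorial_ne_zero
  rw [evenScale, cCoeff, Nat.cast_choose ℂ (by omega : q ≤ 2 * q), show 2 * q - q = q by omega]
  push_cast
  rw [h1, show (2 : ℂ) ^ (4 * q) = (4 ^ q) ^ 2 by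
    rw [← pow_mul, show (4 : ℂ) = 2 ^ 2 by norm_num, ← pow_mul]; ring_nf]
  field_simp

lemma dvd_of_map_ofReal_dvd {σ : Type*} {p r : MvPolynomial σ ℝ}
    (h : map Complex.ofRealHom p ∣ map Complex.ofRealHom r) : p ∣ r := by
  obtain ⟨g, hg⟩ := h
  have hdec : ∃ a b : MvPolynomial σ ℝ,
      g = map Complex.ofRealHom a + C Complex.I * map Complex.ofRealHom b := by
    clear hg
    induction g using MvPolynomial.induction_on with
    | C w =>
      refine ⟨C w.re, C w.im, ?_⟩
      rw [map_C, map_C, ← C_mul, ← C_add]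
      congr 1
      simp [mul_comm Complex.I]
    | add g g' h h' =>
      obtain ⟨a, b, rfl⟩ := h
      obtain ⟨a', b', rfl⟩ := h'
      exact ⟨a + a', b + b', by simp only [map_add]; ring⟩
    | mul_X g i h =>
      obtain ⟨a, b, rfl⟩ := h
      exact ⟨a * X i, b * X i, by simp only [map_mul, map_X]; ring⟩
  obtain ⟨a, b, rfl⟩ := hdec
  refine ⟨a, ?_⟩
  ext m
  have h1 : map Complex.ofRealHom r =
      map Complex.ofRealHom (p * a) + C Complex.I * map Complex.ofRealHom (p * b) := by
    rw [hg, map_mul, map_mul]; ring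
  have h2 := congrArg (fun f => (coeff m f).re) h1
  simpa only [coeff_add, coeff_map, coeff_C_mul, Complex.ofRealHom_eq_coe, Complex.add_re,
    Complex.ofReal_re, Complex.mul_re, Complex.I_re, Complex.I_im, Complex.ofReal_im, zero_mul,
    mul_zero, sub_zero, add_zero] using h2

/-- For every `q ≥ 1`, `(x+z)²` divides `P_q(x,y,z)` in `ℝ[x,y,z]`. -/
theorem sq_dvd_Ppoly (q : ℕ) (hq : 1 ≤ q) :
    (X 0 + X 2 : MvPolynomial (Fin 3) ℝ) ^ 2 ∣ Ppoly q := by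
  apply dvd_of_map_ofReal_dvd
  have hI : Complex.I * Complex.I = -1 := Complex.I_mul_I
  have hI' : -Complex.I * -Complex.I = -1 := by rw [neg_mul_neg, hI]
  have hCI : (C Complex.I * C Complex.I : MvPolynomial (Fin 3) ℂ) = -1 := by
    rw [← C_mul, hI]; simp
  have hCI' : (C (-Complex.I) * C (-Complex.I) : MvPolynomial (Fin 3) ℂ) = -1 := by
    rw [← C_mul, hI']; simp
  have d1 := sq_dvd_apolar_halfSum q hCI (X 0) (X 1) (X 2)
  have d2 := sq_dvd_apolar_halfSum q hCI' (X 0) (X 1) (X 2)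
  have half {ι : ℂ} (hι : ι * ι = -1) (u v : MvPolynomial (Fin 2) (MvPolynomial (Fin 3) ℂ)) :
      halfSum q (C (C ι)) u v = (C (evenScale q) : MvPolynomial (Fin 3) ℂ) • evenForm q u v +
        ((C ι : MvPolynomial (Fin 3) ℂ) * C ((q : ℂ) * 4 ^ q / 2)) • (u ^ (2 * q - 1) * v) := by
    have e (w : ℂ) : algebraMap ℂ (MvPolynomial (Fin 2) (MvPolynomial (Fin 3) ℂ)) w = C (C w) := by
      rw [IsScalarTower.algebraMap_apply ℂ (MvPolynomial (Fin 3) ℂ),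
        MvPolynomial.algebraMap_eq, MvPolynomial.algebraMap_eq]
    have := halfSum_eq hq hι u v
    rwa [e, e, e, ← smul_eq_C_mul, ← smul_eq_C_mul, C_mul] at this
  have hsum := dvd_add d1 d2
  rw [← C_neg, ← C_neg, neg_neg, half hI, half hI', half hI, half hI'] at hsum
  simp only [map_add, map_smul, LinearMap.add_apply, LinearMap.smul_apply, smul_eq_mul,
    apolar_evenForm, apolar_odd (by omega : 2 ≤ 2 * q)] at hsum
  have hc : (C (evenScale q) ^ 2 * C (cCoeff q : ℂ) : MvPolynomial (Fin 3) ℂ) =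
      C ((q : ℂ) * 4 ^ q / 2) ^ 2 * ((2 * q - 1).factorial : MvPolynomial (Fin 3) ℂ) := by
    rw [← C_pow, ← C_mul, evenScale_sq_mul_cCoeff hq, C_mul, C_pow, map_natCast]
  have hscale : IsUnit (C (2 * evenScale q ^ 2) : MvPolynomial (Fin 3) ℂ) := by
    apply IsUnit.map
    have : q ≠ 0 := by omega
    have := q.factorial_ne_zero
    have := (Nat.choose_pos (by omega : q ≤ 2 * q)).ne'
    simp [evenScale, *]
  rw [map_pow, map_add, map_X, map_X, ← hscale.dvd_mul_left]
  convert hsum using 1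
  simp only [Ppoly, map_add, map_sub, map_one, map_mul, map_C, map_pow, map_X, map_neg, map_natCast,
    Complex.ofRealHom_eq_coe, Complex.ofReal_ofNat, Nat.cast_mul, Nat.cast_ofNat]
  rw [show (C (2 : ℂ) : MvPolynomial (Fin 3) ℂ) = 2 from rfl]
  linear_combination (2 * (X 0 ^ (2 * q - 1) * X 2 + (2 * (q : MvPolynomial (Fin 3) ℂ) - 1) *
    X 0 ^ (2 * q - 2) * X 1 ^ 2)) * (hc + C ((q : ℂ) * 4 ^ q / 2) ^ 2 *
      ((2 * q - 1).factorial : MvPolynomial (Fin 3) ℂ) * hCI)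
end

section
/- For every integer q ≥ 1 and integer k ≥ 0: d_q(k) = 0 for every k ≥ 2; d_q(1) = (2q−1)·c_q; and d_q(0) = c_q. -/
open Finset

/-- `d_q(k) = Σ (−1)^{l₁+l₂} a_q(l₁) a_q(l₂) b_q(l₁,l₂,l₁+l₂−k)`, summed over pairs
`0 ≤ l₁,l₂ ≤ q` with `k ≤ l₁+l₂ ≤ 2q−k` and `|l₁−l₂| ≤ k`. -/
noncomputable def dCoeff (q k : ℕ) : ℝ :=
  ∑ l₁ ∈ range (q + 1), ∑ l₂ ∈ range (q + 1),
    if k ≤ l₁ + l₂ ∧ l₁ + l₂ + k ≤ 2 * q ∧ ((l₁ : ℤ) - (l₂ : ℤ)).natAbs ≤ k then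
      (-1 : ℝ) ^ (l₁ + l₂) * aCoeff q l₁ * aCoeff q l₂ * bCoeff q l₁ l₂ (l₁ + l₂ - k)
    else 0

open Polynomial TensorProduct

/-- The linear functional on `ℝ[X]` sending `X ^ m` to `f m`. -/
noncomputable def weightedCoeffSum (f : ℕ → ℝ) : ℝ[X] →ₗ[ℝ] ℝ :=
  Polynomial.lsum fun m => f m • LinearMap.id

theorem weightedCoeffSum_monomial (f : ℕ → ℝ) (m : ℕ) (a : ℝ) :
    weightedCoeffSum f (monomial m a) = f m * a := by
  simp [weightedCoeffSum, Polynomial.sum_monomial_index]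

theorem weightedCoeffSum_X_pow (f : ℕ → ℝ) (m : ℕ) :
    weightedCoeffSum f (X ^ m) = f m := by
  rw [← monomial_one_right_eq_X_pow, weightedCoeffSum_monomial, mul_one]

theorem weightedCoeffSum_X_mul (f : ℕ → ℝ) (p : ℝ[X]) :
    weightedCoeffSum f (X * p) = weightedCoeffSum (fun m => f (m + 1)) p := by
  induction p using Polynomial.induction_on' with
  | add p r hp hr => rw [mul_add, map_add, map_add, hp, hr]
  | monomial m a => rw [X_mul_monomial, weightedCoeffSum_monomial, weightedCoeffSum_monomial]

/-- Multiplication by `(X - 1) ^ 2` is dual to taking second differences of the weight. -/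
theorem weightedCoeffSum_sq_mul (f : ℕ → ℝ) (p : ℝ[X]) :
    weightedCoeffSum f ((X - 1) ^ 2 * p) =
      weightedCoeffSum (fun m => f (m + 2) - 2 * f (m + 1) + f m) p := by
  induction p using Polynomial.induction_on' with
  | add p r hp hr => rw [mul_add, map_add, map_add, hp, hr]
  | monomial m a =>
    have h : (X - 1 : ℝ[X]) ^ 2 * monomial m a =
        X * (X * monomial m a) - (2 : ℝ) • (X * monomial m a) + monomial m a := by
      rw [smul_eq_C_mul, map_ofNat]
      ring
    rw [h]
    simp only [map_add, map_sub, map_smul, X_mul_monomial, weightedCoeffSum_monomial, smul_eq_mul]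
    ring

/-- The functional sending `X ^ m` to `|m - q|`. -/
noncomputable def absMoment (q : ℕ) : ℝ[X] →ₗ[ℝ] ℝ :=
  weightedCoeffSum fun m => |(m : ℝ) - q|

/-- The functional sending `X ^ m` to `(m - q) ^ 2`. -/
noncomputable def sqMoment (q : ℕ) : ℝ[X] →ₗ[ℝ] ℝ :=
  weightedCoeffSum fun m => ((m : ℝ) - q) ^ 2

theorem absMoment_succ_X_mul (q : ℕ) (p : ℝ[X]) :
    absMoment (q + 1) (X * p) = absMoment q p := by
  simp [absMoment, weightedCoeffSum_X_mul]

theorem sqMoment_succ_X_mul (q : ℕ) (p : ℝ[X]) :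
    sqMoment (q + 1) (X * p) = sqMoment q p := by
  simp [sqMoment, weightedCoeffSum_X_mul]

theorem absMoment_succ_sq_mul (q : ℕ) (p : ℝ[X]) :
    absMoment (q + 1) ((X - 1) ^ 2 * p) = 2 * p.coeff q := by
  rw [absMoment, weightedCoeffSum_sq_mul]
  induction p using Polynomial.induction_on' with
  | add p r hp hr => rw [map_add, hp, hr, coeff_add, mul_add]
  | monomial m a =>
    rw [weightedCoeffSum_monomial, coeff_monomial]
    push_cast
    rcases lt_trichotomy m q with h | rfl | h
    · have h' : (m : ℝ) + 1 ≤ q := by exact_mod_cast h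
      rw [if_neg h.ne, abs_of_nonpos (by linarith), abs_of_nonpos (by linarith),
        abs_of_nonpos (by linarith)]
      ring
    · rw [if_pos rfl, abs_of_nonneg (by linarith), abs_of_nonneg (by linarith),
        abs_of_nonpos (by linarith)]
      ring
    · have h' : (q : ℝ) + 1 ≤ m := by exact_mod_cast h
      rw [if_neg h.ne', abs_of_nonneg (by linarith), abs_of_nonneg (by linarith),
        abs_of_nonneg (by linarith)]
      ring

theorem sqMoment_sq_mul (q : ℕ) (p : ℝ[X]) :
    sqMoment q ((X - 1) ^ 2 * p) = 2 * p.eval 1 := by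
  rw [sqMoment, weightedCoeffSum_sq_mul]
  induction p using Polynomial.induction_on' with
  | add p r hp hr => rw [map_add, hp, hr, eval_add, mul_add]
  | monomial m a =>
    rw [weightedCoeffSum_monomial, eval_monomial]
    push_cast
    ring

theorem absMoment_succ_add_one_sq_mul (q : ℕ) (p : ℝ[X]) :
    absMoment (q + 1) ((X + 1) ^ 2 * p) =
      absMoment (q + 1) ((X - 1) ^ 2 * p) + 4 * absMoment q p := by
  have h : (X + 1 : ℝ[X]) ^ 2 * p = (X - 1) ^ 2 * p + (4 : ℝ) • (X * p) := by
    rw [smul_eq_C_mul, map_ofNat]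
    ring
  rw [h, map_add, map_smul, absMoment_succ_X_mul, smul_eq_mul]

theorem sqMoment_succ_add_one_sq_mul (q : ℕ) (p : ℝ[X]) :
    sqMoment (q + 1) ((X + 1) ^ 2 * p) =
      sqMoment (q + 1) ((X - 1) ^ 2 * p) + 4 * sqMoment q p := by
  have h : (X + 1 : ℝ[X]) ^ 2 * p = (X - 1) ^ 2 * p + (4 : ℝ) • (X * p) := by
    rw [smul_eq_C_mul, map_ofNat]
    ring
  rw [h, map_add, map_smul, sqMoment_succ_X_mul, smul_eq_mul]

theorem sqMoment_add_one_pow (q : ℕ) :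
    sqMoment q ((X + 1) ^ (2 * q)) = q / 2 * 4 ^ q := by
  induction q with
  | zero =>
    rw [sqMoment, mul_zero, pow_zero, ← pow_zero (X : ℝ[X]), weightedCoeffSum_X_pow]
    simp
  | succ q ih =>
    rw [show 2 * (q + 1) = 2 + 2 * q by ring, pow_add, sqMoment_succ_add_one_sq_mul,
      sqMoment_sq_mul, ih]
    simp only [eval_pow, eval_add, eval_X, eval_one, pow_mul]
    push_cast
    norm_num
    ring

theorem absMoment_add_one_pow (q : ℕ) :
    absMoment q ((X + 1) ^ (2 * q)) = q * q.centralBinom := by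
  induction q with
  | zero => simpa [absMoment] using weightedCoeffSum_X_pow (fun m => |(m : ℝ) - 0|) 0
  | succ q ih =>
    have h : ((q : ℝ) + 1) * (q + 1).centralBinom = 2 * (2 * q + 1) * q.centralBinom := by
      exact_mod_cast q.succ_mul_centralBinom_succ
    rw [show 2 * (q + 1) = 2 + 2 * q by ring, pow_add, absMoment_succ_add_one_sq_mul,
      absMoment_succ_sq_mul, ih, coeff_X_add_one_pow, ← Nat.centralBinom_eq_two_mul_choose]
    push_cast
    rw [h]
    ring

theorem absMoment_sub_one_mul_add_one_pow (q : ℕ) :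
    absMoment (q + 1) ((X - 1) * (X + 1) ^ (2 * q + 1)) = 0 := by
  induction q with
  | zero =>
    have h : (X - 1 : ℝ[X]) * (X + 1) ^ (2 * 0 + 1) = X ^ 2 - X ^ 0 := by ring
    rw [h, map_sub, absMoment, weightedCoeffSum_X_pow, weightedCoeffSum_X_pow]
    norm_num
  | succ q ih =>
    have h : (X - 1 : ℝ[X]) * (X + 1) ^ (2 * (q + 1) + 1) =
        (X + 1) ^ 2 * ((X - 1) * (X + 1) ^ (2 * q + 1)) := by ring
    rw [h, absMoment_succ_add_one_sq_mul, absMoment_succ_sq_mul, ih, sub_mul, one_mul,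
      coeff_sub, coeff_X_mul, coeff_X_add_one_pow, coeff_X_add_one_pow,
      Nat.choose_symm_half]
    ring

theorem absMoment_add_two (q u r : ℕ) :
    absMoment (q + 1) ((X - 1) ^ (u + 2) * (X + 1) ^ r) =
      absMoment (q + 1) ((X - 1) ^ u * (X + 1) ^ (r + 2)) -
        4 * absMoment q ((X - 1) ^ u * (X + 1) ^ r) := by
  have h := absMoment_succ_add_one_sq_mul q ((X - 1) ^ u * (X + 1) ^ r)
  rw [show (X - 1 : ℝ[X]) ^ (u + 2) * (X + 1) ^ r = (X - 1) ^ 2 * ((X - 1) ^ u * (X + 1) ^ r) by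
    ring, show (X - 1 : ℝ[X]) ^ u * (X + 1) ^ (r + 2) =
      (X + 1) ^ 2 * ((X - 1) ^ u * (X + 1) ^ r) by ring]
  linarith

theorem absMoment_odd (i s : ℕ) :
    absMoment (i + s + 1) ((X - 1) ^ (2 * i + 1) * (X + 1) ^ (2 * s + 1)) = 0 := by
  induction i generalizing s with
  | zero => simpa using absMoment_sub_one_mul_add_one_pow s
  | succ i ih =>
    have h := ih (s + 1)
    rw [show 2 * (s + 1) + 1 = 2 * s + 1 + 2 by ring, ← add_assoc] at h
    rw [show 2 * (i + 1) + 1 = 2 * i + 1 + 2 by ring,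
      show i + 1 + s + 1 = i + s + 1 + 1 by ring, absMoment_add_two, h, ih s]
    ring

theorem absMoment_even (i s : ℕ) :
    absMoment (i + s) ((X - 1) ^ (2 * i) * (X + 1) ^ (2 * s)) =
      -(-1) ^ i * ((i + s : ℕ) / ((i + s).factorial : ℝ)) *
        ((2 * i).factorial * (2 * s).factorial / (i.factorial * s.factorial * (2 * i - 1))) := by
  induction i generalizing s with
  | zero =>
    have h := absMoment_add_one_pow s
    rw [Nat.centralBinom_eq_two_mul_choose, Nat.cast_choose ℝ (by omega),
      show 2 * s - s = s by omega] at h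
    simp only [zero_add, mul_zero, pow_zero, one_mul, h]
    simp
    field_simp
  | succ i ih =>
    have h := ih (s + 1)
    have hi : (i : ℝ) * 2 - 1 ≠ 0 := by
      intro h0
      have h1 : (i : ℤ) * 2 - 1 = 0 := by exact_mod_cast h0
      omega
    rw [show 2 * (s + 1) = 2 * s + 2 by ring, ← add_assoc] at h
    rw [show 2 * (i + 1) = 2 * i + 2 by ring,
      show i + 1 + s = i + s + 1 by ring, absMoment_add_two, h, ih s]
    simp only [Nat.factorial_succ]
    push_cast
    rw [mul_comm 2 (i : ℝ), show 2 * ((i : ℝ) + 1) - 1 = 2 * i + 1 by ring]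
    field_simp
    ring

theorem absMoment_even_eq_aCoeff {q i : ℕ} (hi : i ≤ q) :
    absMoment q ((X - 1) ^ (2 * i) * (X + 1) ^ (2 * q - 2 * i)) =
      -(-1) ^ i * (q / (q.factorial : ℝ)) *
        ((2 * i).factorial * (2 * q - 2 * i).factorial * aCoeff q i) := by
  obtain ⟨s, rfl⟩ := Nat.exists_eq_add_of_le hi
  rw [show 2 * (i + s) - 2 * i = 2 * s by omega, absMoment_even, aCoeff,
    Nat.add_sub_cancel_left]
  simp only [div_eq_mul_inv, mul_inv]
  ring

theorem absMoment_eq_zero_of_odd {q u r : ℕ} (hu : Odd u) (h : u + r = 2 * q) :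
    absMoment q ((X - 1) ^ u * (X + 1) ^ r) = 0 := by
  obtain ⟨i, rfl⟩ := hu
  obtain ⟨s, rfl⟩ : ∃ s, r = 2 * s + 1 := ⟨q - i - 1, by omega⟩
  rw [show q = i + s + 1 by omega, absMoment_odd]

/-- The functional `absMoment q ⊗ absMoment q` on polynomials in two variables. -/
noncomputable def absMomentTensor (q : ℕ) : ℝ[X] ⊗[ℝ] ℝ[X] →ₗ[ℝ] ℝ :=
  LinearMap.mul' ℝ ℝ ∘ₗ TensorProduct.map (absMoment q) (absMoment q)

theorem absMomentTensor_tmul (q : ℕ) (p r : ℝ[X]) :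
    absMomentTensor q (p ⊗ₜ r) = absMoment q p * absMoment q r := by
  simp [absMomentTensor]

theorem absMomentTensor_aeval (q : ℕ) (p : ℝ[X]) :
    absMomentTensor q (aeval ((X : ℝ[X]) ⊗ₜ[ℝ] (X : ℝ[X])) p) = sqMoment q p := by
  induction p using Polynomial.induction_on' with
  | add p r hp hr => rw [map_add, map_add, hp, hr, map_add]
  | monomial m a =>
    rw [← mul_one a, ← smul_eq_mul, ← smul_monomial, monomial_one_right_eq_X_pow, map_smul,
      map_smul, map_smul, aeval_X_pow, Algebra.TensorProduct.tmul_pow, absMomentTensor_tmul,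
      absMoment, sqMoment, weightedCoeffSum_X_pow, weightedCoeffSum_X_pow, abs_mul_abs_self, sq]

theorem X_tmul_X_sub_one :
    (2 : ℝ) • ((X : ℝ[X]) ⊗ₜ[ℝ] (X : ℝ[X]) - 1) =
      (X - 1 : ℝ[X]) ⊗ₜ (X + 1) + (X + 1) ⊗ₜ (X - 1) := by
  rw [Algebra.TensorProduct.one_def, two_smul]
  simp only [sub_tmul, add_tmul, tmul_add, tmul_sub]
  abel

theorem X_tmul_X_add_one :
    (2 : ℝ) • ((X : ℝ[X]) ⊗ₜ[ℝ] (X : ℝ[X]) + 1) =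
      (X - 1 : ℝ[X]) ⊗ₜ (X - 1) + (X + 1) ⊗ₜ (X + 1) := by
  rw [Algebra.TensorProduct.one_def, two_smul]
  simp only [sub_tmul, add_tmul, tmul_add, tmul_sub]
  abel

theorem four_pow_mul_sqMoment (q k N : ℕ) (h : k + N = 2 * q) :
    4 ^ q * sqMoment q ((X - 1) ^ k * (X + 1) ^ N) =
      ∑ u ∈ range (k + 1), ∑ v ∈ range (N + 1), (k.choose u : ℝ) * N.choose v *
        (absMoment q ((X - 1) ^ (u + v) * (X + 1) ^ (k - u + (N - v))) *
          absMoment q ((X - 1) ^ (k - u + v) * (X + 1) ^ (u + (N - v)))) := by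
  have key : (4 : ℝ) ^ q • aeval ((X : ℝ[X]) ⊗ₜ[ℝ] (X : ℝ[X])) ((X - 1 : ℝ[X]) ^ k * (X + 1) ^ N) =
      ((X - 1 : ℝ[X]) ⊗ₜ[ℝ] (X + 1 : ℝ[X]) + (X + 1) ⊗ₜ (X - 1)) ^ k *
        ((X - 1) ⊗ₜ (X - 1) + (X + 1) ⊗ₜ (X + 1)) ^ N := by
    rw [← X_tmul_X_sub_one, ← X_tmul_X_add_one, _root_.smul_pow, _root_.smul_pow, smul_mul_smul_comm,
      ← pow_add, h, pow_mul]
    norm_num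
  rw [← absMomentTensor_aeval, ← smul_eq_mul, ← map_smul, key, add_pow, add_pow,
    sum_mul_sum, map_sum]
  refine sum_congr rfl fun u _ => ?_
  rw [map_sum]
  refine sum_congr rfl fun v _ => ?_
  have hterm : ((X - 1 : ℝ[X]) ⊗ₜ[ℝ] (X + 1 : ℝ[X])) ^ u * ((X + 1) ⊗ₜ (X - 1)) ^ (k - u) *
      (k.choose u : ℝ[X] ⊗[ℝ] ℝ[X]) * (((X - 1) ⊗ₜ (X - 1)) ^ v *
        ((X + 1) ⊗ₜ (X + 1)) ^ (N - v) * (N.choose v : ℝ[X] ⊗[ℝ] ℝ[X])) =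
      ((k.choose u : ℝ) * N.choose v) •
        (((X - 1) ^ (u + v) * (X + 1) ^ (k - u + (N - v))) ⊗ₜ
          ((X - 1) ^ (k - u + v) * (X + 1) ^ (u + (N - v)))) := by
    rw [mul_mul_mul_comm, mul_comm, ← Nat.cast_mul, ← Nat.cast_mul, Nat.cast_smul_eq_nsmul,
      nsmul_eq_mul]
    simp only [Algebra.TensorProduct.tmul_pow, Algebra.TensorProduct.tmul_mul_tmul]
    congr 2 <;> ring
  rw [← absMomentTensor_tmul, hterm, map_smul, smul_eq_mul]

theorem aCoeff_mul_bCoeff_eq_absMoment {q k i j : ℕ} (h : k ≤ i + j) (h' : i + j + k ≤ 2 * q)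
    (hi : i ≤ j + k) (hj : j ≤ i + k) :
    (-1 : ℝ) ^ (i + j) * aCoeff q i * aCoeff q j * bCoeff q i j (i + j - k) *
        ((q / (q.factorial : ℝ)) ^ 2 * ((2 * k).factorial * (2 * q - 2 * k).factorial)) =
      ((2 * k).choose (k + i - j) : ℝ) * (2 * q - 2 * k).choose (i + j - k) *
        (absMoment q ((X - 1) ^ (2 * i) * (X + 1) ^ (2 * q - 2 * i)) *
          absMoment q ((X - 1) ^ (2 * j) * (X + 1) ^ (2 * q - 2 * j))) := by
  rw [absMoment_even_eq_aCoeff (by omega), absMoment_even_eq_aCoeff (by omega),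
    Nat.cast_choose ℝ (by omega), Nat.cast_choose ℝ (by omega), bCoeff,
    show 2 * q + (i + j - k) - 2 * i - 2 * j = 2 * q - 2 * k - (i + j - k) by omega,
    show 2 * i - (i + j - k) = k + i - j by omega,
    show 2 * j - (i + j - k) = 2 * k - (k + i - j) by omega]
  field_simp
  ring

theorem dCoeff_mul_eq_sqMoment {q k : ℕ} (hk : k ≤ q) :
    dCoeff q k * ((q / (q.factorial : ℝ)) ^ 2 *
        ((2 * k).factorial * (2 * q - 2 * k).factorial)) =
      4 ^ q * sqMoment q ((X - 1) ^ (2 * k) * (X + 1) ^ (2 * q - 2 * k)) := by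
  rw [four_pow_mul_sqMoment q _ _ (by omega), dCoeff, ← sum_product', ← sum_product',
    ← sum_filter, sum_mul]
  have hval : ∀ p ∈ (range (q + 1) ×ˢ range (q + 1)).filter (fun p : ℕ × ℕ =>
      k ≤ p.1 + p.2 ∧ p.1 + p.2 + k ≤ 2 * q ∧ ((p.1 : ℤ) - (p.2 : ℤ)).natAbs ≤ k),
      (-1 : ℝ) ^ (p.1 + p.2) * aCoeff q p.1 * aCoeff q p.2 * bCoeff q p.1 p.2 (p.1 + p.2 - k) *
        ((q / (q.factorial : ℝ)) ^ 2 * ((2 * k).factorial * (2 * q - 2 * k).factorial)) =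
      (fun p : ℕ × ℕ => ((2 * k).choose p.1 : ℝ) * (2 * q - 2 * k).choose p.2 *
        (absMoment q ((X - 1) ^ (p.1 + p.2) *
            (X + 1) ^ (2 * k - p.1 + (2 * q - 2 * k - p.2))) *
          absMoment q ((X - 1) ^ (2 * k - p.1 + p.2) *
            (X + 1) ^ (p.1 + (2 * q - 2 * k - p.2))))) (k + p.1 - p.2, p.1 + p.2 - k) := by
    rintro ⟨i, j⟩ h
    simp only [mem_filter, mem_product, mem_range] at h
    rw [aCoeff_mul_bCoeff_eq_absMoment (by omega) (by omega) (by omega) (by omega)]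
    dsimp only
    rw [show k + i - j + (i + j - k) = 2 * i by omega,
      show 2 * k - (k + i - j) + (2 * q - 2 * k - (i + j - k)) = 2 * q - 2 * i by omega,
      show 2 * k - (k + i - j) + (i + j - k) = 2 * j by omega,
      show k + i - j + (2 * q - 2 * k - (i + j - k)) = 2 * q - 2 * j by omega]
  refine sum_bij_ne_zero (fun p _ _ => (k + p.1 - p.2, p.1 + p.2 - k)) ?_ ?_ ?_
    fun p h _ => hval p h
  · rintro ⟨i, j⟩ h _
    simp only [mem_filter, mem_product, mem_range] at h ⊢
    omega
  · rintro ⟨i, j⟩ h _ ⟨i', j'⟩ h' _ e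
    simp only [mem_filter, mem_product, mem_range, Prod.mk.injEq] at h h' e ⊢
    omega
  · rintro ⟨u, v⟩ h h0
    simp only [mem_product, mem_range] at h
    have hev : Even (u + v) := by
      by_contra ho
      rw [Nat.not_even_iff_odd] at ho
      rw [absMoment_eq_zero_of_odd ho (by omega)] at h0
      simp at h0
    obtain ⟨i, hi⟩ := hev
    have hmem : (i, k + i - u) ∈ (range (q + 1) ×ˢ range (q + 1)).filter (fun p : ℕ × ℕ =>
        k ≤ p.1 + p.2 ∧ p.1 + p.2 + k ≤ 2 * q ∧ ((p.1 : ℤ) - (p.2 : ℤ)).natAbs ≤ k) := by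
      simp only [mem_filter, mem_product, mem_range]
      omega
    have huv : ((k + i - (k + i - u), i + (k + i - u) - k) : ℕ × ℕ) = (u, v) :=
      Prod.ext (by dsimp only; omega) (by dsimp only; omega)
    refine ⟨(i, k + i - u), hmem, ?_, huv⟩
    rw [hval _ hmem]
    dsimp only at huv ⊢
    rw [Prod.mk.injEq] at huv
    rw [huv.1, huv.2]
    exact h0

theorem dCoeff_eq_zero_of_lt {q k : ℕ} (h : q < k) : dCoeff q k = 0 :=
  sum_eq_zero fun _ _ => sum_eq_zero fun _ _ => if_neg (by omega)

theorem sqMoment_sub_one_sq_mul_add_one_pow (k N q : ℕ) :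
    sqMoment q ((X - 1) ^ (2 * (k + 1)) * (X + 1) ^ N) = if k = 0 then 2 * 2 ^ N else 0 := by
  rw [show 2 * (k + 1) = 2 + 2 * k by ring, pow_add, mul_assoc, sqMoment_sq_mul]
  by_cases hk : k = 0 <;> simp [hk, one_add_one_eq_two]

/-- For every `q ≥ 1`: `d_q(k) = 0` for all `k ≥ 2`, `d_q(1) = (2q−1)c_q`, and
`d_q(0) = c_q`. -/
theorem dCoeff_values (q : ℕ) (hq : 1 ≤ q) :
    (∀ k : ℕ, 2 ≤ k → dCoeff q k = 0) ∧
    dCoeff q 1 = (2 * (q : ℝ) - 1) * cCoeff q ∧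
    dCoeff q 0 = cCoeff q := by
  have hq0 : (q : ℝ) ≠ 0 := by positivity
  have hfac : ∀ n : ℕ, (n.factorial : ℝ) ≠ 0 := fun n => by positivity
  refine ⟨fun k hk => ?_, ?_, ?_⟩
  · rcases lt_or_ge q k with h | h
    · exact dCoeff_eq_zero_of_lt h
    · obtain ⟨k, rfl⟩ : ∃ m, k = m + 1 := ⟨k - 1, by omega⟩
      have key := dCoeff_mul_eq_sqMoment h
      rw [sqMoment_sub_one_sq_mul_add_one_pow, if_neg (by omega), mul_zero] at key
      exact (mul_eq_zero.mp key).resolve_right (mul_ne_zero (pow_ne_zero _ (div_ne_zero hq0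
        (hfac _))) (mul_ne_zero (hfac _) (hfac _)))
  · obtain ⟨r, rfl⟩ : ∃ r, q = r + 1 := ⟨q - 1, by omega⟩
    have key := dCoeff_mul_eq_sqMoment hq
    have h := sqMoment_sub_one_sq_mul_add_one_pow 0 (2 * r) (r + 1)
    rw [zero_add] at h
    rw [show 2 * (r + 1) - 2 * 1 = 2 * r by omega, h, if_pos rfl, pow_mul] at key
    rw [cCoeff, pow_mul, show 2 * (r + 1) = 2 * r + 1 + 1 by ring, Nat.factorial_succ (2 * r + 1),
      Nat.factorial_succ (2 * r), ← mul_left_inj' (mul_ne_zero (pow_ne_zero 2 (div_ne_zero hq0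
        (hfac (r + 1)))) (mul_ne_zero (hfac (2 * 1)) (hfac (2 * r)))), key,
      show ((2 : ℝ) ^ 4) = 4 * 4 by norm_num, mul_pow, show ((2 : ℝ) ^ 2) = 4 by norm_num]
    have := hfac (r + 1)
    have := hfac (2 * r)
    push_cast at hq0 ⊢
    rw [show 2 * ((r : ℝ) + 1) - 1 = 2 * r + 1 by ring]
    norm_num
    field_simp
    ring
  · have key := dCoeff_mul_eq_sqMoment (Nat.zero_le q)
    rw [mul_zero, pow_zero, one_mul, Nat.sub_zero, sqMoment_add_one_pow] at key
    rw [cCoeff, pow_mul, ← mul_left_inj' (mul_ne_zero (pow_ne_zero 2 (div_ne_zero hq0 (hfac q)))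
      (mul_ne_zero (hfac 0) (hfac (2 * q)))), key, show ((2 : ℝ) ^ 4) = 4 * 4 by norm_num, mul_pow]
    have := hfac q
    have := hfac (2 * q)
    simp only [Nat.factorial_zero]
    field_simp
    norm_num
end

section
/- For every integer q ≥ 1, 2^{4q} / (2q · binomial(2q, q)) = Σ_{l=0}^{q} binomial(2l, l) · binomial(2q−2l, q−l) / (2l−1)². -/
open Finset

lemma two_mul_natCast_sub_one_ne_zero (l : ℕ) : (2 * (l : ℝ) - 1) ≠ 0 := by
  intro h
  have h' : 2 * l = 1 := by exact_mod_cast (sub_eq_zero.mp h)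
  omega

lemma natCast_succ_mul_centralBinom_succ (n : ℕ) :
    ((n : ℝ) + 1) * (n + 1).centralBinom = 2 * (2 * n + 1) * n.centralBinom := by
  exact_mod_cast Nat.succ_mul_centralBinom_succ n

lemma mul_sum_range_centralBinom_mul_div (q n m : ℕ) (h : n + m = q) :
    (q : ℝ) * ∑ l ∈ range n,
        (l.centralBinom : ℝ) * (q - l).centralBinom / (2 * l - 1) =
      -(n * (2 * m + 1) * (n.centralBinom * m.centralBinom / (2 * n - 1))) := by
  induction n generalizing m with
  | zero => simp
  | succ n ih =>
    have hsub : q - n = m + 1 := by omega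
    have hq : (q : ℝ) = n + m + 1 := by
      rw [← h]
      push_cast
      ring
    rw [sum_range_succ, mul_add, ih (m + 1) (by omega), hsub, hq]
    have hn := natCast_succ_mul_centralBinom_succ n
    have hm := natCast_succ_mul_centralBinom_succ m
    have h₁ := two_mul_natCast_sub_one_ne_zero n
    have h₂ : (2 * (n : ℝ) + 1) ≠ 0 := by positivity
    push_cast
    rw [show 2 * ((n : ℝ) + 1) - 1 = 2 * n + 1 by ring]
    have e : ((n : ℝ) + 1) * (2 * m + 1) *
        ((n + 1).centralBinom * m.centralBinom / (2 * (n : ℝ) + 1)) =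
        (m + 1) * n.centralBinom * (m + 1).centralBinom := by
      rw [← mul_div_assoc, div_eq_iff h₂]
      linear_combination (2 * (m : ℝ) + 1) * m.centralBinom * hn -
        (2 * (n : ℝ) + 1) * n.centralBinom * hm
    rw [e]
    linear_combination (-((m : ℝ) + 1) * n.centralBinom * (m + 1).centralBinom) *
      mul_inv_cancel₀ h₁

lemma sum_centralBinom_mul_div_eq_zero {q : ℕ} (hq : 1 ≤ q) :
    ∑ l ∈ range (q + 1),
      (l.centralBinom : ℝ) * (q - l).centralBinom / (2 * l - 1) = 0 := by
  have hq' : (q : ℝ) ≠ 0 := by exact_mod_cast (by omega : q ≠ 0)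
  have h := mul_sum_range_centralBinom_mul_div q q 0 rfl
  apply mul_left_cancel₀ hq'
  rw [sum_range_succ, mul_add, h]
  simp

lemma sum_centralBinom_mul_div_sq_succ {q : ℕ} (hq : 1 ≤ q) :
    (2 * (q : ℝ) + 1) * ∑ l ∈ range (q + 2),
        (l.centralBinom : ℝ) * (q + 1 - l).centralBinom / (2 * l - 1) ^ 2 =
      8 * q * ∑ l ∈ range (q + 1),
        (l.centralBinom : ℝ) * (q - l).centralBinom / (2 * l - 1) ^ 2 := by
  have h₀ := sum_centralBinom_mul_div_eq_zero hq
  have h₁ := sum_centralBinom_mul_div_eq_zero (Nat.le_add_left 1 q)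
  rw [sum_range_succ] at h₁ ⊢
  have key : (2 * (q : ℝ) + 1) * ∑ l ∈ range (q + 1),
        (l.centralBinom : ℝ) * (q + 1 - l).centralBinom / (2 * l - 1) ^ 2 =
      8 * q * ∑ l ∈ range (q + 1),
          (l.centralBinom : ℝ) * (q - l).centralBinom / (2 * l - 1) ^ 2 +
        ∑ l ∈ range (q + 1),
          (l.centralBinom : ℝ) * (q + 1 - l).centralBinom / (2 * l - 1) -
        4 * ∑ l ∈ range (q + 1),
          (l.centralBinom : ℝ) * (q - l).centralBinom / (2 * l - 1) := by
    simp only [mul_sum]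
    rw [← sum_add_distrib, ← sum_sub_distrib]
    refine sum_congr rfl fun l hl => ?_
    obtain ⟨m, rfl⟩ := Nat.exists_eq_add_of_le (Nat.lt_succ_iff.mp (mem_range.mp hl))
    rw [show l + m + 1 - l = m + 1 by omega, Nat.add_sub_cancel_left]
    have hm := natCast_succ_mul_centralBinom_succ m
    have hl := two_mul_natCast_sub_one_ne_zero l
    push_cast
    field_simp
    linear_combination 2 * (l.centralBinom : ℝ) * hm
  have hlast := two_mul_natCast_sub_one_ne_zero (q + 1)
  have hend : (2 * (q : ℝ) + 1) *
      (((q + 1).centralBinom : ℝ) * (q + 1 - (q + 1)).centralBinom /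
        (2 * ((q + 1 : ℕ) : ℝ) - 1) ^ 2) =
      ((q + 1).centralBinom : ℝ) * (q + 1 - (q + 1)).centralBinom /
        (2 * ((q + 1 : ℕ) : ℝ) - 1) := by
    field_simp
    push_cast
    ring
  linear_combination key + hend + h₁ - 4 * h₀

lemma sum_centralBinom_mul_div_sq {q : ℕ} (hq : 1 ≤ q) :
    ∑ l ∈ range (q + 1),
        (l.centralBinom : ℝ) * (q - l).centralBinom / (2 * l - 1) ^ 2 =
      (2 : ℝ) ^ (4 * q) / (2 * (q : ℝ) * q.centralBinom) := by
  induction q, hq using Nat.le_induction with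
  | base => norm_num [sum_range_succ, Nat.centralBinom, Nat.choose]
  | succ q hq ih =>
    have hrec := sum_centralBinom_mul_div_sq_succ hq
    have hq' : (q : ℝ) ≠ 0 := by exact_mod_cast (by omega : q ≠ 0)
    have hc : (q.centralBinom : ℝ) ≠ 0 := by exact_mod_cast q.centralBinom_ne_zero
    have hodd : (2 * (q : ℝ) + 1) ≠ 0 := by positivity
    have hs := natCast_succ_mul_centralBinom_succ q
    rw [ih] at hrec
    apply mul_left_cancel₀ hodd
    rw [hrec]
    push_cast
    rw [mul_assoc 2 ((q : ℝ) + 1), hs]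
    field_simp
    ring

/-- For every `q ≥ 1`,
`2^{4q}/(2q·C(2q,q)) = Σ_{l=0}^{q} C(2l,l)·C(2q−2l,q−l)/(2l−1)²`. -/
theorem central_binomial_identity (q : ℕ) (hq : 1 ≤ q) :
    (2 : ℝ) ^ (4 * q) / (2 * (q : ℝ) * ((2 * q).choose q : ℝ)) =
      ∑ l ∈ range (q + 1),
        ((2 * l).choose l : ℝ) * ((2 * q - 2 * l).choose (q - l) : ℝ) /
          (2 * (l : ℝ) - 1) ^ 2 := by
  simpa only [Nat.centralBinom, Nat.mul_sub] using (sum_centralBinom_mul_div_sq hq).symm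
end

section
/- For every integer q ≥ 2, Σ_{l=0}^{q} binomial(2l, l) · binomial(2q−2l, q−l) · 1/((2l−1)(2q−2l−1)) = 0. -/
open Finset

theorem centralBinom_succ_div_eq_two_mul_catalan (l : ℕ) :
    (Nat.centralBinom (l + 1) : ℝ) / (2 * ((l + 1 : ℕ) : ℝ) - 1) = 2 * (catalan l : ℝ) := by
  have h₁ : ((l : ℝ) + 1) * Nat.centralBinom (l + 1) = 2 * (2 * l + 1) * Nat.centralBinom l := by
    exact_mod_cast Nat.succ_mul_centralBinom_succ l
  have h₂ : ((l : ℝ) + 1) * catalan l = Nat.centralBinom l := by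
    exact_mod_cast succ_mul_catalan_eq_centralBinom l
  have hl : (0 : ℝ) < l + 1 := by positivity
  have hd : (2 * ((l + 1 : ℕ) : ℝ) - 1) = 2 * l + 1 := by push_cast; ring
  rw [hd, div_eq_iff (by positivity)]
  apply mul_left_cancel₀ hl.ne'
  rw [h₁, ← h₂]
  ring

theorem sum_antidiagonal_centralBinom_div_eq_zero (n : ℕ) :
    ∑ p ∈ antidiagonal (n + 2),
      (Nat.centralBinom p.1 : ℝ) / (2 * (p.1 : ℝ) - 1) *
        ((Nat.centralBinom p.2 : ℝ) / (2 * (p.2 : ℝ) - 1)) = 0 := by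
  rw [Nat.sum_antidiagonal_succ, Nat.sum_antidiagonal_succ']
  simp only [centralBinom_succ_div_eq_two_mul_catalan]
  have h : (catalan (n + 1) : ℝ) = ∑ p ∈ antidiagonal n, (catalan p.1 : ℝ) * catalan p.2 := by
    exact_mod_cast catalan_succ' n
  have hs : ∑ p ∈ antidiagonal n, 2 * (catalan p.1 : ℝ) * (2 * (catalan p.2 : ℝ)) =
      4 * (catalan (n + 1) : ℝ) := by
    rw [h, mul_sum]
    exact sum_congr rfl fun p _ => by ring
  rw [hs]
  simp only [Nat.centralBinom_zero, Nat.cast_zero, Nat.cast_one]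
  ring

/-- For every `q ≥ 2`,
`Σ_{l=0}^{q} C(2l,l)·C(2q−2l,q−l)·1/((2l−1)(2q−2l−1)) = 0`. -/
theorem central_binomial_sum_zero (q : ℕ) (hq : 2 ≤ q) :
    ∑ l ∈ range (q + 1),
        ((2 * l).choose l : ℝ) * ((2 * q - 2 * l).choose (q - l) : ℝ) *
          (1 / ((2 * (l : ℝ) - 1) * (2 * (q : ℝ) - 2 * (l : ℝ) - 1))) = 0 := by
  obtain ⟨n, rfl⟩ := Nat.exists_eq_add_of_le' hq
  rw [← sum_antidiagonal_centralBinom_div_eq_zero n, Nat.sum_antidiagonal_eq_sum_range_succ_mk]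
  refine sum_congr rfl fun l hl => ?_
  have hle : l ≤ n + 2 := Nat.lt_succ_iff.mp (mem_range.mp hl)
  rw [← Nat.mul_sub, Nat.cast_sub hle, Nat.centralBinom_eq_two_mul_choose,
    Nat.centralBinom_eq_two_mul_choose, div_mul_div_comm, mul_one_div,
    mul_sub 2 ((n + 2 : ℕ) : ℝ)]
end

section
/- For every integer q ≥ 1 and every integer k ≥ 0 with k ≠ 2q−1, the following recurrence holds: 8q(k−2q−1) · d'_q(k) + (2k−2q−1)(k−2q+1) · d'_{q+1}(k) = 0. -/
open Finset

/-- `d'_q(k) = Σ (2q−l₁−l₂−k)(−1)^{l₁+l₂−1} a_q(l₁) a_q(l₂) b_q(l₁,l₂,l₁+l₂−k)`,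
summed over pairs `0 ≤ l₁,l₂ ≤ q` with `k ≤ l₁+l₂ ≤ 2q−k` and `|l₁−l₂| ≤ k`
(the sign `(−1)^{l₁+l₂−1}` is written as `−(−1)^{l₁+l₂}`). -/
noncomputable def dCoeff' (q k : ℕ) : ℝ :=
  ∑ l₁ ∈ range (q + 1), ∑ l₂ ∈ range (q + 1),
    if k ≤ l₁ + l₂ ∧ l₁ + l₂ + k ≤ 2 * q ∧ ((l₁ : ℤ) - (l₂ : ℤ)).natAbs ≤ k then
      (2 * (q : ℝ) - (l₁ : ℝ) - (l₂ : ℝ) - (k : ℝ)) * (-((-1 : ℝ) ^ (l₁ + l₂))) *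
        aCoeff q l₁ * aCoeff q l₂ * bCoeff q l₁ l₂ (l₁ + l₂ - k)
    else 0

section WeightFunctional

open Polynomial TensorProduct

/-- The weight `a_q(l) · (2l)! · (2q-2l)!`, viewed in `ℂ`. -/
noncomputable def weight (q l : ℕ) : ℂ :=
  ((2 * l).factorial * (2 * q - 2 * l).factorial : ℂ) /
    (l.factorial * (q - l).factorial * (2 * l - 1))

theorem two_mul_sub_one_ne_zero (l : ℤ) : (2 * l - 1 : ℂ) ≠ 0 := by
  exact_mod_cast (show 2 * l - 1 ≠ 0 by lia)

theorem weight_succ_left {q l : ℕ} (h : l ≤ q) :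
    weight (q + 1) l = 2 * (2 * q + 1 - 2 * l) * weight q l := by
  obtain ⟨r, rfl⟩ := Nat.exists_eq_add_of_le h
  have h0 := two_mul_sub_one_ne_zero l
  have hl : (l.factorial : ℂ) ≠ 0 := by exact_mod_cast l.factorial_ne_zero
  have hr : (r.factorial : ℂ) ≠ 0 := by exact_mod_cast r.factorial_ne_zero
  have hr' : (r + 1 : ℂ) ≠ 0 := by exact_mod_cast r.succ_ne_zero
  unfold weight
  rw [show 2 * (l + r + 1) - 2 * l = 2 * r + 1 + 1 by lia,
    show 2 * (l + r) - 2 * l = 2 * r by lia,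
    show l + r + 1 - l = r + 1 by lia, show l + r - l = r by lia]
  simp only [Nat.factorial_succ]
  push_cast at *
  field_simp
  ring

theorem weight_succ_succ (q l : ℕ) :
    weight (q + 1) (l + 1) = 2 * (2 * l - 1) * weight q l := by
  have h0 := two_mul_sub_one_ne_zero l
  have h1 := two_mul_sub_one_ne_zero (l + 1)
  have hl : (l.factorial : ℂ) ≠ 0 := by exact_mod_cast l.factorial_ne_zero
  have hr : ((q - l).factorial : ℂ) ≠ 0 := by exact_mod_cast (q - l).factorial_ne_zero
  have hl' : (l + 1 : ℂ) ≠ 0 := by exact_mod_cast l.succ_ne_zero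
  unfold weight
  rw [show 2 * (q + 1) - 2 * (l + 1) = 2 * q - 2 * l by lia,
    show 2 * (l + 1) = 2 * l + 1 + 1 by lia, show q + 1 - (l + 1) = q - l by lia]
  simp only [Nat.factorial_succ]
  push_cast at *
  field_simp
  ring

/-- The linear functional sending `X ^ (2l)` to `weight q l` for `l < q`, and all other
powers of `X` to `0`. -/
noncomputable def weightFunctional (q : ℕ) : ℂ[X] →ₗ[ℂ] ℂ :=
  ∑ l ∈ range q, weight q l • Polynomial.lcoeff ℂ (2 * l)

theorem weightFunctional_apply (q : ℕ) (P : ℂ[X]) :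
    weightFunctional q P = ∑ l ∈ range q, weight q l * P.coeff (2 * l) := by
  simp [weightFunctional]

theorem weightFunctional_X_pow (q j : ℕ) :
    weightFunctional q (X ^ j) = ∑ l ∈ range q, if j = 2 * l then weight q l else 0 := by
  simp [weightFunctional_apply, coeff_X_pow, eq_comm]

theorem weightFunctional_succ {q : ℕ} {P : ℂ[X]} (hP : P.natDegree < 2 * q) :
    weightFunctional (q + 1) ((1 + X ^ 2) * P) = 4 * q * weightFunctional q P := by
  have hc : P.coeff (2 * q) = 0 := coeff_eq_zero_of_natDegree_lt hP
  simp only [weightFunctional_apply, add_mul, one_mul, coeff_add, mul_add, sum_add_distrib]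
  rw [sum_range_succ, sum_range_succ', hc, mul_sum]
  simp only [show ∀ l, 2 * (l + 1) = 2 * l + 2 by intro l; ring, coeff_X_pow_mul]
  simp only [mul_zero, add_zero, coeff_X_pow_mul', show ¬ (2 ≤ 0) by lia, if_false,
    ← sum_add_distrib]
  refine sum_congr rfl fun l hl => ?_
  rw [weight_succ_left (mem_range.1 hl).le, weight_succ_succ]
  ring

theorem sum_choose_mul_neg_one_pow_div (m j : ℕ) :
    ∑ l ∈ range (m + 1), (m.choose l : ℂ) * (-1) ^ l / (2 * (l + j : ℕ) - 1) =
      2 ^ m * m.factorial / ∏ i ∈ range (m + 1), (2 * (i + j : ℕ) - 1 : ℂ) := by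
  induction m generalizing j with
  | zero => simp
  | succ m ih =>
    have hrec : ∑ l ∈ range (m + 2), ((m + 1).choose l : ℂ) * (-1) ^ l / (2 * (l + j : ℕ) - 1) =
        ∑ l ∈ range (m + 1), (m.choose l : ℂ) * (-1) ^ l / (2 * (l + j : ℕ) - 1) -
        ∑ l ∈ range (m + 1), (m.choose l : ℂ) * (-1) ^ l / (2 * (l + (j + 1) : ℕ) - 1) := by
      have hlast : ∑ l ∈ range (m + 1), (m.choose l : ℂ) * (-1) ^ l / (2 * (l + j : ℕ) - 1) =
          ∑ l ∈ range (m + 2), (m.choose l : ℂ) * (-1) ^ l / (2 * (l + j : ℕ) - 1) := by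
        rw [sum_range_succ _ (m + 1)]; simp
      rw [hlast, sum_range_succ', sum_range_succ' _ (m + 1), add_sub_right_comm,
        ← sum_sub_distrib]
      congr 1
      · refine sum_congr rfl fun l _ => ?_
        rw [Nat.choose_succ_succ, show l + 1 + j = l + (j + 1) by ring]
        push_cast
        ring
      · simp
    have hne (n : ℕ) : (2 * (n : ℂ) - 1) ≠ 0 := by exact_mod_cast two_mul_sub_one_ne_zero n
    rw [hrec, ih, ih, prod_range_succ _ (m + 1), prod_range_succ' _ m, prod_range_succ _ m]
    have hp : ∏ i ∈ range m, (2 * (i + 1 + j : ℕ) - 1 : ℂ) ≠ 0 :=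
      prod_ne_zero_iff.2 fun i _ => hne _
    simp only [show ∀ i, i + (j + 1) = i + 1 + j by intro i; ring]
    have h1 := hne (m + 1 + j)
    have h2 := hne (0 + j)
    field_simp
    rw [Nat.factorial_succ]
    push_cast
    ring

theorem weight_mul_choose {q l : ℕ} (h : l ≤ q) :
    weight (q + 1) l * ((2 * q + 1).choose (2 * l)) =
      2 * (2 * q + 1).factorial / q.factorial * (q.choose l / (2 * l - 1)) := by
  obtain ⟨r, rfl⟩ := Nat.exists_eq_add_of_le h
  have h0 := two_mul_sub_one_ne_zero l
  rw [Nat.cast_choose ℂ (show 2 * l ≤ 2 * (l + r) + 1 by lia),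
    Nat.cast_choose ℂ (show l ≤ l + r by lia), weight,
    show 2 * (l + r) + 1 - 2 * l = 2 * r + 1 by lia,
    show 2 * (l + r + 1) - 2 * l = 2 * r + 1 + 1 by lia,
    show l + r + 1 - l = r + 1 by lia, show l + r - l = r by lia,
    Nat.factorial_succ (2 * r + 1), Nat.factorial_succ r]
  have hf (n : ℕ) : (n.factorial : ℂ) ≠ 0 := by exact_mod_cast n.factorial_ne_zero
  have hr' : (r + 1 : ℂ) ≠ 0 := by exact_mod_cast r.succ_ne_zero
  have := hf l
  have := hf r
  have := hf (l + r)
  have := hf (2 * l)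
  have := hf (2 * r + 1)
  push_cast at *
  field_simp
  ring

theorem factorial_two_mul_eq_prod (q : ℕ) :
    ((2 * q).factorial : ℂ) =
      - (2 ^ q * q.factorial * ∏ i ∈ range (q + 1), (2 * (i : ℂ) - 1)) := by
  induction q with
  | zero => simp
  | succ q ih =>
    rw [show 2 * (q + 1) = 2 * q + 1 + 1 by ring, prod_range_succ, Nat.factorial_succ,
      Nat.factorial_succ, Nat.factorial_succ]
    push_cast
    rw [ih]
    ring

/-- The common factor of the values of `weightFunctional (q + 1)` on the products
`(1 + iX) ^ a * (1 - iX) ^ b`. -/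
def scale (q : ℕ) : ℝ := -2 * 4 ^ q * q.factorial

theorem sum_weight_mul_choose (q : ℕ) :
    ∑ l ∈ range (q + 1), weight (q + 1) l * (((2 * q + 1).choose (2 * l)) * (-1) ^ l) =
      scale q * (2 * q + 1) := by
  have h := sum_choose_mul_neg_one_pow_div q 0
  simp only [add_zero] at h
  have hsum : ∑ l ∈ range (q + 1), weight (q + 1) l * (((2 * q + 1).choose (2 * l)) * (-1) ^ l) =
      2 * (2 * q + 1).factorial / q.factorial *
        ∑ l ∈ range (q + 1), (q.choose l : ℂ) * (-1) ^ l / (2 * l - 1) := by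
    rw [mul_sum]
    refine sum_congr rfl fun l hl => ?_
    rw [← mul_assoc, weight_mul_choose (Nat.lt_succ_iff.1 (mem_range.1 hl))]
    ring
  have hp : ∏ i ∈ range (q + 1), (2 * (i : ℂ) - 1) ≠ 0 :=
    prod_ne_zero_iff.2 fun i _ => by exact_mod_cast two_mul_sub_one_ne_zero i
  have hq : (q.factorial : ℂ) ≠ 0 := by exact_mod_cast q.factorial_ne_zero
  rw [hsum, h, Nat.factorial_succ, scale]
  push_cast
  rw [factorial_two_mul_eq_prod, show (4 : ℂ) = 2 * 2 by norm_num, mul_pow]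
  field_simp

theorem coeff_one_add_C_mul_X_pow (c : ℂ) (n j : ℕ) :
    ((1 + C c * X) ^ n).coeff j = n.choose j * c ^ j := by
  have h : (1 + C c * X) ^ n = ((1 + X) ^ n : ℂ[X]).comp (C c * X) := by simp
  rw [h, comp_C_mul_X_coeff, coeff_one_add_X_pow]

theorem weightFunctional_one_add_C_mul_X_pow (q : ℕ) {c : ℂ} (hc : c ^ 2 = -1) :
    weightFunctional (q + 1) ((1 + C c * X) ^ (2 * q + 1)) = scale q * (2 * q + 1) := by
  rw [weightFunctional_apply, ← sum_weight_mul_choose]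
  simp only [coeff_one_add_C_mul_X_pow, pow_mul, hc]

theorem weightFunctional_mul_pow {c : ℂ} (hc : c ^ 2 = -1) (b d : ℕ) :
    weightFunctional (b + d + 1)
      ((1 + C c * X) ^ (b + 2 * d + 1) * (1 + C (-c) * X) ^ b) =
      scale (b + d) * (2 * d + 1) := by
  induction b with
  | zero => simpa using weightFunctional_one_add_C_mul_X_pow d hc
  | succ b ih =>
    have hmul : (1 + C c * X) ^ (b + 1 + 2 * d + 1) * (1 + C (-c) * X) ^ (b + 1) =
        (1 + X ^ 2) * ((1 + C c * X) ^ (b + 2 * d + 1) * (1 + C (-c) * X) ^ b) := by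
      have : (1 + C c * X) * (1 + C (-c) * X) = 1 + X ^ 2 := by
        have h2 : (C c : ℂ[X]) ^ 2 = -1 := by rw [← C_pow, hc]; simp
        rw [C_neg]
        linear_combination (-X ^ 2) * h2
      rw [← this]
      ring
    rw [hmul, show b + 1 + d + 1 = (b + d + 1) + 1 by ring, weightFunctional_succ, ih, scale,
      scale, show b + 1 + d = b + d + 1 by ring, Nat.factorial_succ]
    · push_cast
      ring
    · have : ((1 + C c * X) ^ (b + 2 * d + 1) * (1 + C (-c) * X) ^ b).natDegree ≤
          (b + 2 * d + 1) * 1 + b * 1 := by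
        refine natDegree_mul_le_of_le (natDegree_pow_le_of_le _ ?_)
          (natDegree_pow_le_of_le _ ?_) <;> compute_degree
      lia

theorem weightFunctional_mul_pow_sq {q a b : ℕ} (h : a + b = 2 * q + 1) :
    weightFunctional (q + 1) ((1 + C Complex.I * X) ^ a * (1 + C (-Complex.I) * X) ^ b) ^ 2 =
      scale q ^ 2 * ((a : ℂ) - b) ^ 2 := by
  rcases le_total b a with hab | hab
  · obtain ⟨d, rfl⟩ : ∃ d, a = b + 2 * d + 1 := ⟨(a - b) / 2, by lia⟩
    obtain rfl : q = b + d := by lia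
    rw [weightFunctional_mul_pow Complex.I_sq]
    push_cast
    ring
  · obtain ⟨d, rfl⟩ : ∃ d, b = a + 2 * d + 1 := ⟨(b - a) / 2, by lia⟩
    obtain rfl : q = a + d := by lia
    have := weightFunctional_mul_pow (c := -Complex.I) (by simp) a d
    rw [neg_neg] at this
    rw [mul_comm, this]
    push_cast
    ring

section BinaryForms

variable {R T : Type*} [CommRing R] [CommRing T] [Algebra R T] {Φ : T →ₗ[R] R} {A B : T} {c : R}
  {N : ℕ}

theorem map_add_pow_mul (h : ∀ a b : ℕ, a + b = N → Φ (A ^ a * B ^ b) = c * ((a : R) - b) ^ 2)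
    (M a b : ℕ) (hN : M + a + b = N) :
    Φ ((A + B) ^ M * (A ^ a * B ^ b)) = c * 2 ^ M * (((a : R) - b) ^ 2 + M) := by
  induction M generalizing a b with
  | zero => simpa using h a b (by lia)
  | succ M ih =>
    have e : (A + B) ^ (M + 1) * (A ^ a * B ^ b) =
        (A + B) ^ M * (A ^ (a + 1) * B ^ b) + (A + B) ^ M * (A ^ a * B ^ (b + 1)) := by ring
    rw [e, map_add, ih _ _ (by lia), ih _ _ (by lia)]
    push_cast
    ring

theorem map_sub_mul_add_pow_mul
    (h : ∀ a b : ℕ, a + b = N → Φ (A ^ a * B ^ b) = c * ((a : R) - b) ^ 2)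
    (M a b : ℕ) (hN : M + a + b + 1 = N) :
    Φ ((A - B) * ((A + B) ^ M * (A ^ a * B ^ b))) = c * 2 ^ M * (4 * ((a : R) - b)) := by
  have e : (A - B) * ((A + B) ^ M * (A ^ a * B ^ b)) =
      (A + B) ^ M * (A ^ (a + 1) * B ^ b) - (A + B) ^ M * (A ^ a * B ^ (b + 1)) := by ring
  rw [e, map_sub, map_add_pow_mul h _ _ _ (by lia), map_add_pow_mul h _ _ _ (by lia)]
  push_cast
  ring

theorem map_sub_sq_mul_add_pow_mul
    (h : ∀ a b : ℕ, a + b = N → Φ (A ^ a * B ^ b) = c * ((a : R) - b) ^ 2)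
    (M a b : ℕ) (hN : M + a + b + 2 = N) :
    Φ ((A - B) ^ 2 * ((A + B) ^ M * (A ^ a * B ^ b))) = c * 2 ^ M * 8 := by
  have e : (A - B) ^ 2 * ((A + B) ^ M * (A ^ a * B ^ b)) =
      (A - B) * ((A + B) ^ M * (A ^ (a + 1) * B ^ b)) -
        (A - B) * ((A + B) ^ M * (A ^ a * B ^ (b + 1))) := by ring
  rw [e, map_sub, map_sub_mul_add_pow_mul h _ _ _ (by lia),
    map_sub_mul_add_pow_mul h _ _ _ (by lia)]
  push_cast
  ring

theorem map_sub_pow_mul_add_pow_mul_eq_zero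
    (h : ∀ a b : ℕ, a + b = N → Φ (A ^ a * B ^ b) = c * ((a : R) - b) ^ 2)
    (r M a b : ℕ) (hN : M + a + b + (r + 3) = N) :
    Φ ((A - B) ^ (r + 3) * ((A + B) ^ M * (A ^ a * B ^ b))) = 0 := by
  induction r generalizing a b with
  | zero =>
    have e : (A - B) ^ (0 + 3) * ((A + B) ^ M * (A ^ a * B ^ b)) =
        (A - B) ^ 2 * ((A + B) ^ M * (A ^ (a + 1) * B ^ b)) -
          (A - B) ^ 2 * ((A + B) ^ M * (A ^ a * B ^ (b + 1))) := by ring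
    rw [e, map_sub, map_sub_sq_mul_add_pow_mul h _ _ _ (by lia),
      map_sub_sq_mul_add_pow_mul h _ _ _ (by lia), sub_self]
  | succ r ih =>
    have e : (A - B) ^ (r + 1 + 3) * ((A + B) ^ M * (A ^ a * B ^ b)) =
        (A - B) ^ (r + 3) * ((A + B) ^ M * (A ^ (a + 1) * B ^ b)) -
          (A - B) ^ (r + 3) * ((A + B) ^ M * (A ^ a * B ^ (b + 1))) := by ring
    rw [e, map_sub, ih _ _ (by lia), ih _ _ (by lia), sub_self]

end BinaryForms

/-- The tensor square of `weightFunctional q`. -/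
noncomputable def weightPairing (q : ℕ) : ℂ[X] ⊗[ℂ] ℂ[X] →ₗ[ℂ] ℂ :=
  LinearMap.mul' ℂ ℂ ∘ₗ TensorProduct.map (weightFunctional q) (weightFunctional q)

theorem weightPairing_tmul (q : ℕ) (P Q : ℂ[X]) :
    weightPairing q (P ⊗ₜ Q) = weightFunctional q P * weightFunctional q Q := by
  simp [weightPairing]

/-- The pairing of the binary forms `(1 - XY) ^ M * (X + Y) ^ n`. -/
noncomputable def formPairing (q M n : ℕ) : ℂ :=
  weightPairing q ((1 - X ⊗ₜ[ℂ] X) ^ M * (X ⊗ₜ[ℂ] 1 + 1 ⊗ₜ[ℂ] X) ^ n)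

theorem weightPairing_pow_mul_pow (q a b : ℕ) (h : a + b = 2 * q + 1) :
    weightPairing (q + 1)
      (((1 + C Complex.I * X) ⊗ₜ[ℂ] (1 + C Complex.I * X)) ^ a *
        ((1 + C (-Complex.I) * X) ⊗ₜ[ℂ] (1 + C (-Complex.I) * X)) ^ b) =
      scale q ^ 2 * ((a : ℂ) - b) ^ 2 := by
  rw [Algebra.TensorProduct.tmul_pow, Algebra.TensorProduct.tmul_pow,
    Algebra.TensorProduct.tmul_mul_tmul, weightPairing_tmul, ← sq, weightFunctional_mul_pow_sq h]

theorem tmul_add_tmul :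
    ((1 + C Complex.I * X) ⊗ₜ[ℂ] (1 + C Complex.I * X) +
        (1 + C (-Complex.I) * X) ⊗ₜ[ℂ] (1 + C (-Complex.I) * X) : ℂ[X] ⊗[ℂ] ℂ[X]) =
      (2 : ℂ) • (1 - X ⊗ₜ[ℂ] X) := by
  simp only [← smul_eq_C_mul, add_tmul, tmul_add, ← smul_tmul', tmul_smul, smul_add, smul_smul,
    neg_mul_neg, Complex.I_mul_I, Algebra.TensorProduct.one_def]
  module

theorem tmul_sub_tmul :
    ((1 + C Complex.I * X) ⊗ₜ[ℂ] (1 + C Complex.I * X) -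
        (1 + C (-Complex.I) * X) ⊗ₜ[ℂ] (1 + C (-Complex.I) * X) : ℂ[X] ⊗[ℂ] ℂ[X]) =
      (2 * Complex.I) • (X ⊗ₜ[ℂ] 1 + 1 ⊗ₜ[ℂ] X) := by
  simp only [← smul_eq_C_mul, add_tmul, tmul_add, ← smul_tmul', tmul_smul, smul_add, smul_smul,
    neg_mul_neg, Complex.I_mul_I]
  module

theorem formPairing_eq (q M n : ℕ) :
    2 ^ M * (2 * Complex.I) ^ n * formPairing q M n =
      weightPairing q (((1 + C Complex.I * X) ⊗ₜ[ℂ] (1 + C Complex.I * X) -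
          (1 + C (-Complex.I) * X) ⊗ₜ[ℂ] (1 + C (-Complex.I) * X)) ^ n *
        (((1 + C Complex.I * X) ⊗ₜ[ℂ] (1 + C Complex.I * X) +
          (1 + C (-Complex.I) * X) ⊗ₜ[ℂ] (1 + C (-Complex.I) * X)) ^ M *
        (((1 + C Complex.I * X) ⊗ₜ[ℂ] (1 + C Complex.I * X)) ^ 0 *
          ((1 + C (-Complex.I) * X) ⊗ₜ[ℂ] (1 + C (-Complex.I) * X)) ^ 0))) := by
  rw [tmul_add_tmul, tmul_sub_tmul, formPairing, _root_.smul_pow,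
    _root_.smul_pow, pow_zero, pow_zero, mul_one, mul_one, smul_mul_smul_comm, map_smul,
    smul_eq_mul, mul_comm (2 ^ M), mul_comm (_ ^ M)]

theorem formPairing_zero (q : ℕ) :
    formPairing (q + 1) (2 * q + 1) 0 = scale q ^ 2 * (2 * q + 1) := by
  have h := formPairing_eq (q + 1) (2 * q + 1) 0
  rw [pow_zero, pow_zero, one_mul,
    map_add_pow_mul (weightPairing_pow_mul_pow q) _ _ _ (by lia)] at h
  have h2 : (2 : ℂ) ^ (2 * q + 1) ≠ 0 := pow_ne_zero _ two_ne_zero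
  apply mul_left_cancel₀ h2
  push_cast at h
  linear_combination h

theorem formPairing_two (q : ℕ) :
    formPairing (q + 2) (2 * q + 1) 2 = -2 * scale (q + 1) ^ 2 := by
  have h := formPairing_eq (q + 2) (2 * q + 1) 2
  rw [map_sub_sq_mul_add_pow_mul (weightPairing_pow_mul_pow (q + 1)) _ _ _ (by lia)] at h
  have h2 : (2 : ℂ) ^ (2 * q + 1) ≠ 0 := pow_ne_zero _ two_ne_zero
  apply mul_left_cancel₀ h2
  rw [mul_pow, Complex.I_sq] at h
  linear_combination (-1 / 4) * h

theorem formPairing_eq_zero {q M n : ℕ} (hn : 3 ≤ n) (h : M + n = 2 * q + 1) :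
    formPairing (q + 1) M n = 0 := by
  obtain ⟨r, rfl⟩ := Nat.exists_eq_add_of_le' hn
  have h := formPairing_eq (q + 1) M (r + 3)
  rw [map_sub_pow_mul_add_pow_mul_eq_zero (weightPairing_pow_mul_pow q) _ _ _ _ (by lia)] at h
  have h2 : (2 : ℂ) ^ M * (2 * Complex.I) ^ (r + 3) ≠ 0 :=
    mul_ne_zero (pow_ne_zero _ two_ne_zero) (pow_ne_zero _ (by simp))
  exact (mul_eq_zero.1 h).resolve_left h2

theorem formPairing_eq_sum (q M n : ℕ) :
    formPairing q M n = ∑ m ∈ range (M + 1), ∑ i ∈ range (n + 1),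
      (-1) ^ m * M.choose m * n.choose i *
        (weightFunctional q (X ^ (m + i)) * weightFunctional q (X ^ (m + (n - i)))) := by
  rw [formPairing, sub_eq_neg_add, add_pow, add_pow, sum_mul_sum, map_sum]
  refine sum_congr rfl fun m _ => ?_
  rw [map_sum]
  refine sum_congr rfl fun i _ => ?_
  rw [← weightPairing_tmul,
    ← smul_eq_mul (a := (-1 : ℂ) ^ m * M.choose m * n.choose i), ← map_smul]
  congr 1
  have e : (X ^ (m + i) : ℂ[X]) ⊗ₜ[ℂ] (X ^ (m + (n - i)) : ℂ[X]) =
      (X ⊗ₜ[ℂ] X) ^ m * ((X ⊗ₜ[ℂ] 1) ^ i * (1 ⊗ₜ[ℂ] X) ^ (n - i)) := by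
    simp [Algebra.TensorProduct.tmul_pow, pow_add]
  rw [e]
  refine Eq.trans ?_ (Algebra.smul_def (R := ℂ) (A := ℂ[X] ⊗[ℂ] ℂ[X]) _ _).symm
  simp only [map_mul, map_pow, map_neg, map_one, map_natCast]
  ring

theorem sum_choose_ite {q k l₁ l₂ : ℕ} (hk : k ≤ q) :
    ∑ m ∈ range (2 * q + 1 - 2 * k + 1), ∑ i ∈ range (2 * k + 1),
      (if m + i = 2 * l₁ ∧ m + (2 * k - i) = 2 * l₂ then
        (-1 : ℂ) ^ m * (2 * q + 1 - 2 * k).choose m * (2 * k).choose i else 0) =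
      if k ≤ l₁ + l₂ ∧ l₁ + l₂ + k ≤ 2 * q + 1 ∧ ((l₁ : ℤ) - (l₂ : ℤ)).natAbs ≤ k then
        (-1 : ℂ) ^ (l₁ + l₂ - k) * (2 * q + 1 - 2 * k).choose (l₁ + l₂ - k) *
          (2 * k).choose (l₁ + k - l₂) else 0 := by
  split_ifs with h
  · rw [sum_eq_single (l₁ + l₂ - k), sum_eq_single (l₁ + k - l₂), if_pos (by lia)]
    · intro i hi hne
      rw [if_neg (by lia)]
    · intro hi
      exact absurd (mem_range.2 (by lia)) hi
    · intro m hm hne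
      refine sum_eq_zero fun i hi => if_neg ?_
      have := mem_range.1 hi
      lia
    · intro hm
      exact absurd (mem_range.2 (by lia)) hm
  · refine sum_eq_zero fun m hm => sum_eq_zero fun i hi => if_neg ?_
    have := mem_range.1 hi
    have := mem_range.1 hm
    lia

theorem sum_comm_four {α β γ δ M : Type*} [AddCommMonoid M] (s : Finset α) (t : Finset β)
    (u : Finset γ) (v : Finset δ) (f : α → β → γ → δ → M) :
    ∑ a ∈ s, ∑ b ∈ t, ∑ c ∈ u, ∑ d ∈ v, f a b c d =
      ∑ c ∈ u, ∑ d ∈ v, ∑ a ∈ s, ∑ b ∈ t, f a b c d :=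
  calc
    _ = ∑ a ∈ s, ∑ c ∈ u, ∑ d ∈ v, ∑ b ∈ t, f a b c d :=
      sum_congr rfl fun _ _ => sum_comm.trans (sum_congr rfl fun _ _ => sum_comm)
    _ = _ := sum_comm.trans (sum_congr rfl fun _ _ => sum_comm)

theorem formPairing_eq_sum_weight {q k : ℕ} (hk : k ≤ q) :
    formPairing (q + 1) (2 * q + 1 - 2 * k) (2 * k) =
      ∑ l₁ ∈ range (q + 1), ∑ l₂ ∈ range (q + 1), weight (q + 1) l₁ * weight (q + 1) l₂ *
        if k ≤ l₁ + l₂ ∧ l₁ + l₂ + k ≤ 2 * q + 1 ∧ ((l₁ : ℤ) - (l₂ : ℤ)).natAbs ≤ k then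
          (-1 : ℂ) ^ (l₁ + l₂ - k) * (2 * q + 1 - 2 * k).choose (l₁ + l₂ - k) *
            (2 * k).choose (l₁ + k - l₂) else 0 := by
  simp only [← sum_choose_ite hk, formPairing_eq_sum, weightFunctional_X_pow, mul_sum]
  rw [sum_comm_four]
  refine sum_congr rfl fun m _ => sum_congr rfl fun i _ => ?_
  rw [sum_comm]
  refine sum_congr rfl fun l₂ _ => ?_
  rw [sum_mul, mul_sum]
  refine sum_congr rfl fun l₁ _ => ?_
  rw [ite_and]
  split_ifs <;> ring

theorem weight_eq (q l : ℕ) :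
    weight q l = aCoeff q l * ((2 * l).factorial * (2 * q - 2 * l).factorial) := by
  rw [weight, aCoeff]
  push_cast
  rw [one_div_mul_one_div]
  ring

theorem dCoeff'_summand {q k l₁ l₂ : ℕ} (hk : k ≤ q) :
    (((if k ≤ l₁ + l₂ ∧ l₁ + l₂ + k ≤ 2 * (q + 1) ∧ ((l₁ : ℤ) - (l₂ : ℤ)).natAbs ≤ k then
      (2 * ((q + 1 : ℕ) : ℝ) - (l₁ : ℝ) - (l₂ : ℝ) - (k : ℝ)) * (-((-1 : ℝ) ^ (l₁ + l₂))) *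
        aCoeff (q + 1) l₁ * aCoeff (q + 1) l₂ * bCoeff (q + 1) l₁ l₂ (l₁ + l₂ - k)
      else 0 : ℝ)) : ℂ) =
    -(-1) ^ k / ((2 * k).factorial * (2 * q + 1 - 2 * k).factorial) *
      (weight (q + 1) l₁ * weight (q + 1) l₂ *
        if k ≤ l₁ + l₂ ∧ l₁ + l₂ + k ≤ 2 * q + 1 ∧ ((l₁ : ℤ) - (l₂ : ℤ)).natAbs ≤ k then
          (-1 : ℂ) ^ (l₁ + l₂ - k) * (2 * q + 1 - 2 * k).choose (l₁ + l₂ - k) *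
            (2 * k).choose (l₁ + k - l₂) else 0) := by
  by_cases h : k ≤ l₁ + l₂ ∧ l₁ + l₂ + k ≤ 2 * q + 1 ∧ ((l₁ : ℤ) - (l₂ : ℤ)).natAbs ≤ k
  · rw [if_pos h, if_pos (by lia)]
    obtain ⟨m, hm⟩ := Nat.exists_eq_add_of_le h.1
    obtain ⟨p, hp⟩ := Nat.exists_eq_add_of_le h.2.1
    obtain ⟨i, hi⟩ : ∃ i, l₁ + k = i + l₂ := ⟨l₁ + k - l₂, by lia⟩
    obtain ⟨j, hj⟩ : ∃ j, l₂ + k = j + l₁ := ⟨l₂ + k - l₁, by lia⟩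
    have hp' : 2 * ((q + 1 : ℕ) : ℝ) - l₁ - l₂ - k = p + 1 := by
      have : (2 * q + 1 : ℝ) = l₁ + l₂ + k + p := by exact_mod_cast hp
      push_cast
      linear_combination this
    have hM : 2 * q + 1 - 2 * k = m + p := by lia
    have hK : 2 * k = i + j := by lia
    rw [hp', show l₁ + l₂ - k = m by lia, show l₁ + k - l₂ = i by lia, hM, hK,
      Nat.cast_choose ℂ (Nat.le_add_right m p), Nat.cast_choose ℂ (Nat.le_add_right i j),
      Nat.add_sub_cancel_left, Nat.add_sub_cancel_left, hm, bCoeff,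
      show 2 * (q + 1) + m - 2 * l₁ - 2 * l₂ = p + 1 by lia,
      show 2 * l₁ - m = i by lia, show 2 * l₂ - m = j by lia, weight_eq, weight_eq,
      Nat.factorial_succ]
    have hf (n : ℕ) : (n.factorial : ℂ) ≠ 0 := by exact_mod_cast n.factorial_ne_zero
    have := hf m
    have := hf p
    have := hf i
    have := hf j
    have := hf (m + p)
    have := hf (i + j)
    have hp0 : (p + 1 : ℂ) ≠ 0 := by exact_mod_cast p.succ_ne_zero
    push_cast
    field_simp
    ring
  · rw [if_neg h]
    split_ifs with h'
    · have : 2 * ((q + 1 : ℕ) : ℝ) - l₁ - l₂ - k = 0 := by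
        have : (2 * (q + 1 : ℕ) : ℝ) = l₁ + l₂ + k := by
          exact_mod_cast (show 2 * (q + 1) = l₁ + l₂ + k by lia)
        linear_combination this
      rw [this]
      simp
    · simp

theorem dCoeff'_eq_formPairing {q k : ℕ} (hk : k ≤ q) :
    (dCoeff' (q + 1) k : ℂ) =
      -(-1) ^ k / ((2 * k).factorial * (2 * q + 1 - 2 * k).factorial) *
        formPairing (q + 1) (2 * q + 1 - 2 * k) (2 * k) := by
  rw [dCoeff', formPairing_eq_sum_weight hk]
  simp only [Complex.ofReal_sum, dCoeff'_summand hk, mul_sum]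
  refine (sum_range_succ _ _).trans ((add_eq_left.2 (sum_eq_zero fun l₂ hl₂ => ?_)).trans
    (sum_congr rfl fun l₁ hl₁ => ?_))
  · have := mem_range.1 hl₂
    rw [if_neg (by lia), mul_zero, mul_zero]
  · have := mem_range.1 hl₁
    rw [sum_range_succ, if_neg (by lia), mul_zero, mul_zero, add_zero]

theorem dCoeff'_zero (q : ℕ) :
    dCoeff' (q + 1) 0 = -(scale q ^ 2 / (2 * q).factorial) := by
  apply Complex.ofReal_injective
  have hf : ((2 * q).factorial : ℂ) ≠ 0 := by exact_mod_cast (2 * q).factorial_ne_zero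
  have hq : (2 * q + 1 : ℂ) ≠ 0 := by exact_mod_cast (2 * q).succ_ne_zero
  rw [dCoeff'_eq_formPairing q.zero_le, mul_zero, Nat.sub_zero, formPairing_zero,
    Nat.factorial_succ]
  push_cast
  field_simp
  simp

theorem dCoeff'_one (q : ℕ) :
    dCoeff' (q + 2) 1 = -(scale (q + 1) ^ 2 / (2 * q + 1).factorial) := by
  apply Complex.ofReal_injective
  have hf : ((2 * q + 1).factorial : ℂ) ≠ 0 := by exact_mod_cast (2 * q + 1).factorial_ne_zero
  rw [dCoeff'_eq_formPairing (by lia), mul_one,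
    show 2 * (q + 1) + 1 - 2 = 2 * q + 1 by lia, formPairing_two]
  push_cast
  field_simp
  simp

theorem dCoeff'_eq_zero_of_le {q k : ℕ} (h : q ≤ k) : dCoeff' q k = 0 := by
  refine sum_eq_zero fun l₁ hl₁ => sum_eq_zero fun l₂ hl₂ => ?_
  split_ifs with hc
  · have h0 : 2 * (q : ℝ) = l₁ + l₂ + k := by
      exact_mod_cast (show 2 * q = l₁ + l₂ + k by lia)
    have : 2 * (q : ℝ) - l₁ - l₂ - k = 0 := by linear_combination h0
    simp [this]
  · rfl

theorem dCoeff'_eq_zero (q : ℕ) {k : ℕ} (hk : 2 ≤ k) : dCoeff' q k = 0 := by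
  rcases le_or_gt q k with h | h
  · exact dCoeff'_eq_zero_of_le h
  · obtain ⟨q, rfl⟩ : ∃ p, q = p + 1 := ⟨q - 1, by lia⟩
    apply Complex.ofReal_injective
    rw [dCoeff'_eq_formPairing (by lia), formPairing_eq_zero (by lia) (by lia), mul_zero,
      Complex.ofReal_zero]

end WeightFunctional

/-- For every `q ≥ 1` and `k ≥ 0` with `k ≠ 2q − 1`:
`8q(k−2q−1)·d'_q(k) + (2k−2q−1)(k−2q+1)·d'_{q+1}(k) = 0`. -/
theorem dCoeff'_recurrence (q k : ℕ) (hq : 1 ≤ q) (hk : k ≠ 2 * q - 1) :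
    8 * (q : ℝ) * ((k : ℝ) - 2 * (q : ℝ) - 1) * dCoeff' q k +
      (2 * (k : ℝ) - 2 * (q : ℝ) - 1) * ((k : ℝ) - 2 * (q : ℝ) + 1) * dCoeff' (q + 1) k = 0 := by
  obtain ⟨q, rfl⟩ := Nat.exists_eq_add_of_le' hq
  rcases lt_or_ge k 2 with hk2 | hk2
  · interval_cases k
    · rw [dCoeff'_zero, dCoeff'_zero, scale, scale, show 2 * (q + 1) = 2 * q + 1 + 1 by ring,
        Nat.factorial_succ (2 * q + 1), Nat.factorial_succ (2 * q), Nat.factorial_succ q]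
      push_cast
      field_simp
      ring
    · obtain ⟨q, rfl⟩ : ∃ p, q = p + 1 := ⟨q - 1, by lia⟩
      rw [dCoeff'_one, dCoeff'_one, scale, scale,
        show 2 * (q + 1) + 1 = 2 * q + 1 + 1 + 1 by ring,
        Nat.factorial_succ (2 * q + 1 + 1), Nat.factorial_succ (2 * q + 1),
        Nat.factorial_succ (q + 1)]
      push_cast
      field_simp
      ring
  · rw [dCoeff'_eq_zero _ hk2, dCoeff'_eq_zero _ hk2]
    ring
end

section
/- For every real x with |x| ≤ 1, arcsin(x)² = (1/2) · Σ_{q=1}^{∞} 2^{2q} x^{2q} / (q² · binomial(2q, q)). -/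
open Real Filter Topology

/-- The Taylor formula with integral remainder at `0`, applied to `sin ^ (2 * (n + 1))`. -/
lemma sin_pow_eq_integral_sub_integral (n : ℕ) (θ : ℝ) :
    sin θ ^ (2 * (n + 1)) =
      (2 * n + 2) * (2 * n + 1) * (∫ t in (0 : ℝ)..θ, (θ - t) * sin t ^ (2 * n)) -
        (2 * n + 2) ^ 2 * ∫ t in (0 : ℝ)..θ, (θ - t) * sin t ^ (2 * (n + 1)) := by
  have hderiv (t : ℝ) : HasDerivAt
      (fun t => (θ - t) * ((2 * n + 2) * sin t ^ (2 * n + 1) * cos t) + sin t ^ (2 * n + 2))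
      ((2 * n + 2) * (2 * n + 1) * ((θ - t) * sin t ^ (2 * n)) -
        (2 * n + 2) ^ 2 * ((θ - t) * sin t ^ (2 * (n + 1)))) t := by
    have hpow (k : ℕ) := (hasDerivAt_sin t).pow (k + 1)
    refine HasDerivAt.congr_deriv ((((hasDerivAt_id t).const_sub θ).mul
      (((hpow (2 * n)).const_mul (2 * n + 2 : ℝ)).mul (hasDerivAt_cos t))).add
      (hpow (2 * n + 1))) ?_
    simp only [id, Pi.mul_apply, Pi.pow_apply, add_tsub_cancel_right]
    push_cast
    linear_combination ((2 * n + 2) * (2 * n + 1) * (θ - t) * sin t ^ (2 * n)) *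
      sin_sq_add_cos_sq t
  have h_integ (k : ℕ) :
      IntervalIntegrable (fun t => (θ - t) * sin t ^ k) MeasureTheory.volume 0 θ :=
    Continuous.intervalIntegrable (by fun_prop) _ _
  have hFTC := intervalIntegral.integral_eq_sub_of_hasDerivAt (a := 0) (b := θ)
    (fun t _ => hderiv t) (Continuous.intervalIntegrable (by fun_prop) _ _)
  rw [intervalIntegral.integral_sub ((h_integ _).const_mul _) ((h_integ _).const_mul _),
    intervalIntegral.integral_const_mul, intervalIntegral.integral_const_mul] at hFTC
  rw [hFTC]
  simp [mul_add]

lemma sq_eq_sum_sin_pow_add_integral (θ : ℝ) (N : ℕ) :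
    θ ^ 2 = ∑ m ∈ Finset.range N,
      (1 / 2) * ((2 : ℝ) ^ (2 * (m + 1)) * sin θ ^ (2 * (m + 1)) /
        (((m : ℝ) + 1) ^ 2 * ((m + 1).centralBinom : ℝ))) +
      2 * (4 ^ N / (N.centralBinom : ℝ)) *
        ∫ t in (0 : ℝ)..θ, (θ - t) * sin t ^ (2 * N) := by
  induction N with
  | zero =>
    have h : ∫ t in (0 : ℝ)..θ, (θ - t) = θ ^ 2 / 2 := by
      rw [intervalIntegral.integral_sub (by simp) (by simp)]
      simp only [intervalIntegral.integral_const, integral_id, smul_eq_mul]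
      ring
    simp [h]
    ring
  | succ N ih =>
    rw [Finset.sum_range_succ, sin_pow_eq_integral_sub_integral N θ]
    refine ih.trans ?_
    have hc : ((N : ℝ) + 1) * (N + 1).centralBinom = 2 * (2 * N + 1) * N.centralBinom :=
      mod_cast Nat.succ_mul_centralBinom_succ N
    have hc_div : ((N + 1).centralBinom : ℝ) = 2 * (2 * N + 1) * N.centralBinom / (N + 1) := by
      rw [← hc]
      field_simp
    have h0 : (N.centralBinom : ℝ) ≠ 0 := mod_cast N.centralBinom_ne_zero
    rw [hc_div, show (2 : ℝ) ^ (2 * (N + 1)) = 4 ^ N * 4 by rw [pow_mul, pow_succ]; norm_num,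
      pow_succ (4 : ℝ)]
    field_simp
    ring

lemma four_pow_div_centralBinom_sq_le (n : ℕ) :
    ((4 : ℝ) ^ n / n.centralBinom) ^ 2 ≤ 4 * n + 1 := by
  induction n with
  | zero => simp
  | succ n ih =>
    have hc : ((n : ℝ) + 1) * (n + 1).centralBinom = 2 * (2 * n + 1) * n.centralBinom :=
      mod_cast Nat.succ_mul_centralBinom_succ n
    have h0 : (n.centralBinom : ℝ) ≠ 0 := mod_cast n.centralBinom_ne_zero
    have h1 : ((n + 1).centralBinom : ℝ) ≠ 0 := mod_cast (n + 1).centralBinom_ne_zero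
    have hstep : (4 : ℝ) ^ (n + 1) / (n + 1).centralBinom =
        4 ^ n / n.centralBinom * ((2 * n + 2) / (2 * n + 1)) := by
      rw [pow_succ]
      field_simp
      linear_combination (-2 : ℝ) * hc
    rw [hstep, mul_pow]
    refine (mul_le_mul_of_nonneg_right ih (sq_nonneg _)).trans ?_
    rw [div_pow, ← mul_div_assoc, div_le_iff₀ (by positivity)]
    push_cast
    nlinarith

lemma integral_sub_mul_sin_pow_nonneg {θ : ℝ} (h0 : 0 ≤ θ) (n : ℕ) :
    0 ≤ ∫ t in (0 : ℝ)..θ, (θ - t) * sin t ^ (2 * n) :=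
  intervalIntegral.integral_nonneg h0 fun t ht =>
    mul_nonneg (sub_nonneg.2 ht.2) (by rw [pow_mul]; positivity)

lemma integral_sub_mul_sin_pow_le {θ : ℝ} (h0 : 0 ≤ θ) (h1 : θ ≤ π / 2) (n : ℕ) :
    ∫ t in (0 : ℝ)..θ, (θ - t) * sin t ^ (2 * n) ≤ π / 2 / (2 * n + 1) := by
  have h_integ : ∫ t in (0 : ℝ)..θ, π / 2 * (sin t ^ (2 * n) * cos t) =
      π / 2 * (sin θ ^ (2 * n + 1) / (2 * n + 1)) := by
    rw [intervalIntegral.integral_const_mul]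
    simpa using integral_sin_pow_mul_cos_pow_odd (a := 0) (b := θ) (2 * n) 0
  calc ∫ t in (0 : ℝ)..θ, (θ - t) * sin t ^ (2 * n)
      ≤ ∫ t in (0 : ℝ)..θ, π / 2 * (sin t ^ (2 * n) * cos t) := by
        refine intervalIntegral.integral_mono_on h0
          (Continuous.intervalIntegrable (by fun_prop) _ _)
          (Continuous.intervalIntegrable (by fun_prop) _ _) fun t ht => ?_
        have hcos : π / 2 - t ≤ π / 2 * cos t := by
          have h := mul_le_sin (x := π / 2 - t) (by linarith [ht.2]) (by linarith [ht.1])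
          rw [sin_pi_div_two_sub] at h
          calc π / 2 - t = π / 2 * (2 / π * (π / 2 - t)) := by field_simp
            _ ≤ _ := by gcongr
        have hsin : 0 ≤ sin t ^ (2 * n) := by rw [pow_mul]; positivity
        calc (θ - t) * sin t ^ (2 * n) ≤ π / 2 * cos t * sin t ^ (2 * n) := by
              gcongr
              linarith
          _ = _ := by ring
    _ = π / 2 * (sin θ ^ (2 * n + 1) / (2 * n + 1)) := h_integ
    _ ≤ π / 2 * (1 / (2 * n + 1)) := by
        gcongr
        exact pow_le_one₀ (sin_nonneg_of_nonneg_of_le_pi h0 (by linarith [pi_pos])) (sin_le_one θ)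
    _ = _ := by ring

lemma tendsto_four_pow_div_centralBinom_mul_integral {θ : ℝ} (h0 : 0 ≤ θ) (h1 : θ ≤ π / 2) :
    Tendsto (fun n : ℕ => 2 * (4 ^ n / (n.centralBinom : ℝ)) *
      ∫ t in (0 : ℝ)..θ, (θ - t) * sin t ^ (2 * n)) atTop (𝓝 0) := by
  have hlim : Tendsto (fun n : ℕ => 2 * π / √(4 * n + 1)) atTop (𝓝 0) :=
    (tendsto_sqrt_atTop.comp (tendsto_atTop_add_const_right _ _
      (tendsto_natCast_atTop_atTop.const_mul_atTop four_pos))).const_div_atTop _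
  refine squeeze_zero (fun n => ?_) (fun n => ?_) hlim
  · have := integral_sub_mul_sin_pow_nonneg h0 n
    positivity
  · have hs : (0 : ℝ) < √(4 * n + 1) := by positivity
    have hsq : √(4 * n + 1 : ℝ) ^ 2 = 4 * n + 1 := sq_sqrt (by positivity)
    calc 2 * (4 ^ n / (n.centralBinom : ℝ)) * ∫ t in (0 : ℝ)..θ, (θ - t) * sin t ^ (2 * n)
        ≤ 2 * √(4 * n + 1) * (π / 2 / (2 * n + 1)) := by
          gcongr
          · exact integral_sub_mul_sin_pow_nonneg h0 n
          · exact le_sqrt_of_sq_le (four_pow_div_centralBinom_sq_le n)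
          · exact integral_sub_mul_sin_pow_le h0 h1 n
      _ = π * √(4 * n + 1) / (2 * n + 1) := by ring
      _ ≤ 2 * π / √(4 * n + 1) := by
          rw [div_le_div_iff₀ (by positivity) hs]
          nlinarith [pi_pos]

lemma hasSum_sin_pow_of_nonneg {θ : ℝ} (h0 : 0 ≤ θ) (h1 : θ ≤ π / 2) :
    HasSum (fun m : ℕ => (1 / 2) * ((2 : ℝ) ^ (2 * (m + 1)) * sin θ ^ (2 * (m + 1)) /
      (((m : ℝ) + 1) ^ 2 * ((m + 1).centralBinom : ℝ)))) (θ ^ 2) := by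
  rw [hasSum_iff_tendsto_nat_of_nonneg]
  · have h := (tendsto_four_pow_div_centralBinom_mul_integral h0 h1).const_sub (θ ^ 2)
    rw [sub_zero] at h
    refine h.congr fun N => ?_
    rw [sub_eq_iff_eq_add]
    exact sq_eq_sum_sin_pow_add_integral θ N
  · intro m
    have : 0 ≤ sin θ ^ (2 * (m + 1)) := by rw [pow_mul]; positivity
    positivity

/-- For every real `x` with `|x| ≤ 1`,
`arcsin(x)² = (1/2)·Σ_{q=1}^{∞} 2^{2q} x^{2q}/(q²·C(2q,q))` (the series converges;
it is indexed below by `q = m + 1`, `m ∈ ℕ`). -/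
theorem arcsin_sq_series (x : ℝ) (hx : |x| ≤ 1) :
    HasSum
      (fun m : ℕ =>
        (1 / 2) * ((2 : ℝ) ^ (2 * (m + 1)) * x ^ (2 * (m + 1)) /
          (((m : ℝ) + 1) ^ 2 * ((2 * (m + 1)).choose (m + 1) : ℝ))))
      (Real.arcsin x ^ 2) := by
  have habs : arcsin |x| ^ 2 = arcsin x ^ 2 := by
    rcases abs_choice x with h | h <;> simp [h]
  have h := hasSum_sin_pow_of_nonneg (arcsin_nonneg.2 (abs_nonneg x)) (arcsin_le_pi_div_two |x|)
  rw [sin_arcsin (by linarith [abs_nonneg x]) hx, habs] at h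
  simpa only [(even_two_mul _).pow_abs, Nat.centralBinom_eq_two_mul_choose] using h
end

section
/- For every real x with |x| < 1/2, Σ_{l=0}^{∞} binomial(2l, l) · x^{2l} / (2l−1)² = √(1 − 4x²) + 2x · arcsin(2x). -/
theorem Real.choose_half_add_sub_one (n : ℕ) :
    Ring.choose ((1 / 2 : ℝ) + n - 1) n = n.centralBinom / 4 ^ n := by
  have key : ∀ k : ℕ,
      (ascPochhammer ℝ k).eval (1 / 2) = k.factorial * (k.centralBinom / 4 ^ k) := by
    intro k
    induction k with
    | zero => simp
    | succ k ih =>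
      have h : ((k : ℝ) + 1) * (k + 1).centralBinom = 2 * (2 * k + 1) * k.centralBinom := by
        exact_mod_cast Nat.succ_mul_centralBinom_succ k
      rw [ascPochhammer_succ_eval, ih, Nat.factorial_succ]
      push_cast
      field_simp
      linear_combination -2 * 4 ^ k * h
  have h := Ring.factorial_nsmul_multichoose_eq_ascPochhammer (1 / 2 : ℝ) n
  rw [Polynomial.ascPochhammer_smeval_eq_eval, key, nsmul_eq_mul] at h
  have hn : (n.factorial : ℝ) ≠ 0 := by positivity
  rw [← mul_left_cancel₀ hn h, Ring.multichoose_eq]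

theorem Real.hasSum_centralBinom_mul_pow {x : ℝ} (hx : |x| < 1 / 2) :
    HasSum (fun n : ℕ => (n.centralBinom : ℝ) * x ^ (2 * n)) (1 / √(1 - (2 * x) ^ 2)) := by
  have hlt : ‖(2 * x) ^ 2‖ < 1 := by
    rw [abs_lt] at hx
    rw [Real.norm_of_nonneg (sq_nonneg _)]
    nlinarith
  have h := (Real.one_div_one_sub_rpow_hasFPowerSeriesOnBall_zero (1 / 2)).hasSum
    (y := (2 * x) ^ 2) (by
      rw [Metric.mem_eball, edist_zero_right, ← ofReal_norm]
      exact ENNReal.ofReal_lt_one.2 hlt)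
  rw [zero_add, ← Real.sqrt_eq_rpow] at h
  convert! h using 2 with n
  rw [FormalMultilinearSeries.ofScalars_apply_eq, Real.choose_half_add_sub_one, smul_eq_mul,
    ← pow_mul, mul_pow, pow_mul 2]
  norm_num
  field_simp

/-- Termwise integration: a series of functions that sums to `F` at one point of a preconnected
open set, and whose termwise derivatives are dominated and sum to the derivative of `F`,
sums to `F` on the whole set. -/
theorem hasSum_of_hasSum_hasDerivAt {g g' : ℕ → ℝ → ℝ} {F F' : ℝ → ℝ} {s : Set ℝ} {u : ℕ → ℝ}
    {x₀ : ℝ} (hs : IsOpen s) (hs' : IsPreconnected s) (hu : Summable u)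
    (hg : ∀ n, ∀ y ∈ s, HasDerivAt (g n) (g' n y) y) (hb : ∀ n, ∀ y ∈ s, ‖g' n y‖ ≤ u n)
    (hF : ∀ y ∈ s, HasDerivAt F (F' y) y) (h' : ∀ y ∈ s, HasSum (g' · y) (F' y))
    (hx₀ : x₀ ∈ s) (h₀ : HasSum (g · x₀) (F x₀)) {x : ℝ} (hx : x ∈ s) :
    HasSum (g · x) (F x) := by
  have hd : ∀ y ∈ s, HasDerivAt (fun z => ∑' n, g n z) (F' y) y := fun y hy =>
    (h' y hy).tsum_eq ▸
      hasDerivAt_tsum_of_isPreconnected hu hs hs' hg hb hx₀ h₀.summable hy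
  rw [(summable_of_summable_hasDerivAt_of_isPreconnected hu hs hs' hg hb hx₀ h₀.summable
    hx).hasSum_iff]
  exact hs.eqOn_of_deriv_eq hs' (fun y hy => (hd y hy).differentiableAt.differentiableWithinAt)
    (fun y hy => (hF y hy).differentiableAt.differentiableWithinAt)
    (fun y hy => (hd y hy).deriv.trans (hF y hy).deriv.symm) hx₀ h₀.tsum_eq hx

theorem Real.hasDerivAt_arcsin_two_mul {y : ℝ} (hy : |y| < 1 / 2) :
    HasDerivAt (fun y => Real.arcsin (2 * y)) (2 / √(1 - (2 * y) ^ 2)) y := by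
  rw [abs_lt] at hy
  have h := (Real.hasDerivAt_arcsin (x := 2 * y) (by linarith) (by linarith)).comp y
    ((hasDerivAt_id y).const_mul 2)
  refine h.congr_deriv ?_
  ring

theorem Real.hasSum_arcsin_two_mul {x : ℝ} (hx : |x| < 1 / 2) :
    HasSum (fun n : ℕ => (n.centralBinom : ℝ) * x ^ (2 * n + 1) / (2 * n + 1))
      (Real.arcsin (2 * x) / 2) := by
  obtain ⟨r, hxr, hr⟩ := exists_between hx
  have hr₀ : 0 < r := (abs_nonneg x).trans_lt hxr
  have hmem : ∀ {y : ℝ}, y ∈ Set.Ioo (-r) r → |y| < r := fun h => abs_lt.2 h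
  refine hasSum_of_hasSum_hasDerivAt (s := Set.Ioo (-r) r) (x₀ := 0)
    (g := fun n y => (n.centralBinom : ℝ) * y ^ (2 * n + 1) / (2 * n + 1))
    (F := fun y => Real.arcsin (2 * y) / 2)
    isOpen_Ioo isPreconnected_Ioo
    (Real.hasSum_centralBinom_mul_pow (by rwa [abs_of_pos hr₀])).summable
    (g' := fun n y => (n.centralBinom : ℝ) * y ^ (2 * n)) ?_ ?_ ?_
    (fun y hy => Real.hasSum_centralBinom_mul_pow ((hmem hy).trans hr))
    ⟨by linarith, hr₀⟩ ?_ (abs_lt.1 hxr)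
  · intro n y _
    refine (((hasDerivAt_pow (2 * n + 1) y).const_mul _).div_const _).congr_deriv ?_
    push_cast
    field_simp
  · intro n y hy
    rw [norm_mul, norm_pow, Real.norm_natCast, Real.norm_eq_abs]
    have := (hmem hy).le
    gcongr
  · intro y hy
    refine ((Real.hasDerivAt_arcsin_two_mul ((hmem hy).trans hr)).div_const 2).congr_deriv ?_
    ring
  · simp

theorem Real.hasDerivAt_sqrt_add_mul_arcsin {y : ℝ} (hy : |y| < 1 / 2) :
    HasDerivAt (fun y => √(1 - 4 * y ^ 2) + 2 * y * Real.arcsin (2 * y))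
      (2 * Real.arcsin (2 * y)) y := by
  have hpos : 0 < 1 - 4 * y ^ 2 := by
    rw [abs_lt] at hy
    nlinarith
  have h₁ := ((((hasDerivAt_pow 2 y).const_mul 4).const_sub 1).sqrt hpos.ne')
  have h₂ := ((hasDerivAt_id y).const_mul 2).mul (Real.hasDerivAt_arcsin_two_mul hy)
  refine (h₁.add h₂).congr_deriv ?_
  have hs : √(1 - 4 * y ^ 2) ≠ 0 := (Real.sqrt_pos.2 hpos).ne'
  rw [show (2 * y) ^ 2 = 4 * y ^ 2 by ring]
  simp only [id]
  field_simp
  ring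


/-- For every real `x` with `|x| < 1/2`,
`Σ_{l=0}^{∞} C(2l,l)·x^{2l}/(2l−1)² = √(1−4x²) + 2x·arcsin(2x)` (the series converges). -/
theorem central_binomial_series (x : ℝ) (hx : |x| < 1 / 2) :
    HasSum
      (fun l : ℕ => ((2 * l).choose l : ℝ) * x ^ (2 * l) / (2 * (l : ℝ) - 1) ^ 2)
      (Real.sqrt (1 - 4 * x ^ 2) + 2 * x * Real.arcsin (2 * x)) := by
  obtain ⟨r, hxr, hr⟩ := exists_between hx
  have hr₀ : 0 < r := (abs_nonneg x).trans_lt hxr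
  have hmem : ∀ {y : ℝ}, y ∈ Set.Ioo (-r) r → |y| < r := fun h => abs_lt.2 h
  have hsucc : ∀ n : ℕ,
      ((n : ℝ) + 1) * ((2 * (n + 1)).choose (n + 1) : ℝ) = 2 * (2 * n + 1) * n.centralBinom :=
    fun n => by exact_mod_cast Nat.succ_mul_centralBinom_succ n
  rw [← hasSum_nat_add_iff' 1]
  refine hasSum_of_hasSum_hasDerivAt (s := Set.Ioo (-r) r) (x₀ := 0)
    (g := fun n y => ((2 * (n + 1)).choose (n + 1) : ℝ) * y ^ (2 * (n + 1)) /
      (2 * ((n + 1 : ℕ) : ℝ) - 1) ^ 2)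
    (F := fun y => √(1 - 4 * y ^ 2) + 2 * y * Real.arcsin (2 * y) -
      ∑ l ∈ Finset.range 1, ((2 * l).choose l : ℝ) * y ^ (2 * l) / (2 * (l : ℝ) - 1) ^ 2)
    (F' := fun y => 2 * Real.arcsin (2 * y))
    isOpen_Ioo isPreconnected_Ioo
    ((Real.hasSum_arcsin_two_mul (by rwa [abs_of_pos hr₀])).mul_left 4).summable
    (g' := fun n y => 4 * ((n.centralBinom : ℝ) * y ^ (2 * n + 1) / (2 * n + 1))) ?_ ?_ ?_ ?_
    ⟨by linarith, hr₀⟩ ?_ (abs_lt.1 hxr)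
  · intro n y _
    refine (((hasDerivAt_pow (2 * (n + 1)) y).const_mul _).div_const _).congr_deriv ?_
    rw [show 2 * (n + 1) - 1 = 2 * n + 1 by lia]
    push_cast
    rw [show 2 * ((n : ℝ) + 1) - 1 = 2 * n + 1 by ring]
    field_simp
    linear_combination 2 * y ^ (2 * n + 1) * hsucc n
  · intro n y hy
    have := (hmem hy).le
    have hn : ‖(2 * n + 1 : ℝ)‖ = 2 * n + 1 := Real.norm_of_nonneg (by positivity)
    rw [norm_mul, norm_div, norm_mul, norm_pow, hn, Real.norm_natCast, Real.norm_eq_abs y,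
      Real.norm_ofNat]
    gcongr
  · intro y hy
    simpa using (Real.hasDerivAt_sqrt_add_mul_arcsin ((hmem hy).trans hr)).sub_const 1
  · intro y hy
    have h := (Real.hasSum_arcsin_two_mul ((hmem hy).trans hr)).mul_left 4
    rwa [show 4 * (Real.arcsin (2 * y) / 2) = 2 * Real.arcsin (2 * y) by ring] at h
  · simp
end

section
/- Let φ(u) = (1/√(2π)) e^{−u²/2} be the standard Gaussian density and Φ(u) = ∫_{−∞}^{u} φ(v) dv the standard Gaussian distribution function. Then for every A ∈ ℝ, α ∈ ℝ, σ > 0 and every positive integer J, σ · ∫_0^{πJ/σ} φ(A cos(σy + α)) · [ 2φ(A sin(σy + α)) − A sin(σy + α) · (2Φ(−A sin(σy + α)) − 1) ] dy = J. -/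
open MeasureTheory Real

/-- The standard Gaussian density `φ(u) = e^{−u²/2}/√(2π)`. -/
noncomputable def gaussPDF (u : ℝ) : ℝ := Real.exp (-u ^ 2 / 2) / Real.sqrt (2 * Real.pi)

/-- The standard Gaussian distribution function `Φ(u) = ∫_{−∞}^{u} φ(v) dv`. -/
noncomputable def gaussCDF (u : ℝ) : ℝ := ∫ v in Set.Iic u, gaussPDF v

theorem continuous_gaussPDF : Continuous gaussPDF := by
  unfold gaussPDF
  fun_prop

theorem gaussPDF_neg (u : ℝ) : gaussPDF (-u) = gaussPDF u := by
  simp [gaussPDF]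

theorem gaussPDF_zero_mul_self : gaussPDF 0 * gaussPDF 0 = 1 / (2 * π) := by
  have h : √(2 * π) * √(2 * π) = 2 * π := Real.mul_self_sqrt (by positivity)
  simp only [gaussPDF]
  rw [div_mul_div_comm, h]
  simp

theorem hasDerivAt_gaussPDF (u : ℝ) : HasDerivAt gaussPDF (-u * gaussPDF u) u := by
  have h : HasDerivAt (fun v : ℝ => -v ^ 2 / 2) (-u) u := by
    refine ((hasDerivAt_pow 2 u).neg.div_const 2).congr_deriv ?_
    simp
    ring
  refine (h.exp.div_const √(2 * π)).congr_deriv ?_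
  simp only [gaussPDF]
  ring

theorem gaussPDF_eq (u : ℝ) : gaussPDF u = Real.exp (-(1 / 2) * u ^ 2) / √(2 * π) := by
  simp only [gaussPDF]
  congr 2
  ring

theorem integrable_gaussPDF : Integrable gaussPDF := by
  rw [funext gaussPDF_eq]
  exact (integrable_exp_neg_mul_sq (by norm_num)).div_const _

theorem integral_gaussPDF : ∫ u, gaussPDF u = 1 := by
  simp_rw [gaussPDF_eq]
  rw [integral_div, integral_gaussian, show π / (1 / 2) = 2 * π by ring]
  exact div_self (by positivity)

theorem hasDerivAt_gaussCDF (u : ℝ) : HasDerivAt gaussCDF (gaussPDF u) u := by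
  have h : gaussCDF = fun x => gaussCDF 0 + ∫ v in (0 : ℝ)..x, gaussPDF v := by
    funext x
    rw [← intervalIntegral.integral_Iic_sub_Iic integrable_gaussPDF.integrableOn
      integrable_gaussPDF.integrableOn]
    simp [gaussCDF]
  rw [h]
  exact (intervalIntegral.integral_hasDerivAt_right
    (continuous_gaussPDF.intervalIntegrable _ _)
    continuous_gaussPDF.stronglyMeasurable.stronglyMeasurableAtFilter
    continuous_gaussPDF.continuousAt).const_add _

theorem continuous_gaussCDF : Continuous gaussCDF :=
  continuous_iff_continuousAt.2 fun u => (hasDerivAt_gaussCDF u).continuousAt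

theorem gaussCDF_neg (u : ℝ) : gaussCDF (-u) = 1 - gaussCDF u := by
  have h := integral_comp_neg_Ioi u gaussPDF
  simp_rw [gaussPDF_neg] at h
  have h' := intervalIntegral.integral_Iic_add_Ioi (b := u) integrable_gaussPDF.integrableOn
    integrable_gaussPDF.integrableOn
  rw [h, integral_gaussPDF] at h'
  simp only [gaussCDF]
  linarith

/-- The common value of the amplitude derivative of the crossing density and the phase derivative
of the flux `cos θ * φ (a cos θ) * (2 Φ (-a sin θ) - 1)`. -/
noncomputable def crossingFluxDeriv (a θ : ℝ) : ℝ :=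
  -(a * cos θ ^ 2) * gaussPDF (a * cos θ) *
      (2 * gaussPDF (a * sin θ) - a * sin θ * (2 * gaussCDF (-(a * sin θ)) - 1)) -
    gaussPDF (a * cos θ) * (sin θ * (2 * gaussCDF (-(a * sin θ)) - 1))

theorem continuous_crossingFluxDeriv :
    Continuous (fun p : ℝ × ℝ => crossingFluxDeriv p.1 p.2) := by
  have := continuous_gaussPDF
  have := continuous_gaussCDF
  unfold crossingFluxDeriv
  fun_prop

theorem hasDerivAt_two_mul_gaussCDF_neg (u : ℝ) :
    HasDerivAt (fun v => 2 * gaussCDF (-v) - 1) (-2 * gaussPDF u) u := by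
  refine ((((hasDerivAt_gaussCDF (-u)).comp u (hasDerivAt_neg u)).const_mul 2).sub_const
    1).congr_deriv ?_
  rw [gaussPDF_neg]
  ring

theorem hasDerivAt_crossing_density_amplitude (θ a : ℝ) :
    HasDerivAt (fun b => gaussPDF (b * cos θ) *
      (2 * gaussPDF (b * sin θ) - b * sin θ * (2 * gaussCDF (-(b * sin θ)) - 1)))
      (crossingFluxDeriv a θ) a := by
  have hc : HasDerivAt (fun b => b * cos θ) (cos θ) a := hasDerivAt_mul_const _
  have hs : HasDerivAt (fun b => b * sin θ) (sin θ) a := hasDerivAt_mul_const _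
  have h₁ := (hasDerivAt_gaussPDF (a * cos θ)).comp a hc
  have h₂ := (hasDerivAt_gaussPDF (a * sin θ)).comp a hs
  have h₃ := (hasDerivAt_two_mul_gaussCDF_neg (a * sin θ)).comp a hs
  refine (h₁.mul ((h₂.const_mul 2).sub (hs.mul h₃))).congr_deriv ?_
  simp only [crossingFluxDeriv, Function.comp_apply, Pi.sub_apply, Pi.mul_apply]
  ring

theorem hasDerivAt_crossing_flux_phase (a θ : ℝ) :
    HasDerivAt (fun t => cos t * gaussPDF (a * cos t) * (2 * gaussCDF (-(a * sin t)) - 1))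
      (crossingFluxDeriv a θ) θ := by
  have h₁ := (hasDerivAt_gaussPDF (a * cos θ)).comp θ ((hasDerivAt_cos θ).const_mul a)
  have h₂ := (hasDerivAt_two_mul_gaussCDF_neg (a * sin θ)).comp θ ((hasDerivAt_sin θ).const_mul a)
  refine (((hasDerivAt_cos θ).mul h₁).mul h₂).congr_deriv ?_
  simp only [crossingFluxDeriv, Function.comp_apply, Pi.mul_apply]
  ring

theorem periodic_crossing_flux (a : ℝ) :
    Function.Periodic
      (fun t => cos t * gaussPDF (a * cos t) * (2 * gaussCDF (-(a * sin t)) - 1)) π := by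
  intro t
  simp only [cos_add_pi, sin_add_pi, mul_neg, gaussPDF_neg, gaussCDF_neg]
  ring

theorem integral_crossingFluxDeriv_phase (a α : ℝ) (J : ℕ) :
    ∫ θ in α..α + J * π, crossingFluxDeriv a θ = 0 := by
  have hc : Continuous (crossingFluxDeriv a) :=
    continuous_crossingFluxDeriv.comp (by fun_prop : Continuous fun θ : ℝ => (a, θ))
  rw [intervalIntegral.integral_eq_sub_of_hasDerivAt
    (fun θ _ => hasDerivAt_crossing_flux_phase a θ) (hc.intervalIntegrable _ _)]
  exact sub_eq_zero.2 ((periodic_crossing_flux a).nat_mul J α)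

theorem integral_crossing_density (A α : ℝ) (J : ℕ) :
    ∫ θ in α..α + J * π, gaussPDF (A * cos θ) *
      (2 * gaussPDF (A * sin θ) - A * sin θ * (2 * gaussCDF (-(A * sin θ)) - 1)) = J := by
  have hpt (θ : ℝ) : gaussPDF (A * cos θ) *
      (2 * gaussPDF (A * sin θ) - A * sin θ * (2 * gaussCDF (-(A * sin θ)) - 1)) =
      (∫ a in (0 : ℝ)..A, crossingFluxDeriv a θ) + 1 / π := by
    have hc : Continuous fun a => crossingFluxDeriv a θ :=
      continuous_crossingFluxDeriv.comp (by fun_prop : Continuous fun a : ℝ => (a, θ))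
    rw [intervalIntegral.integral_eq_sub_of_hasDerivAt
      (fun a _ => hasDerivAt_crossing_density_amplitude θ a) (hc.intervalIntegrable _ _)]
    have h : 2 * (gaussPDF 0 * gaussPDF 0) = 1 / π := by
      rw [gaussPDF_zero_mul_self]
      field_simp
    simp only [zero_mul, sub_zero]
    linarith
  have hswap : ∫ θ in α..α + J * π, ∫ a in (0 : ℝ)..A, crossingFluxDeriv a θ = 0 := by
    have hc : Continuous (Function.uncurry fun θ a => crossingFluxDeriv a θ) :=
      continuous_crossingFluxDeriv.comp continuous_swap
    rw [intervalIntegral_intervalIntegral_swap]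
    · simp [integral_crossingFluxDeriv_phase]
    · exact (hc.continuousOn.integrableOn_compact (isCompact_uIcc.prod isCompact_uIcc)).mono_set
        (Set.prod_mono Set.uIoc_subset_uIcc Set.uIoc_subset_uIcc)
  have hcont : Continuous fun θ => ∫ a in (0 : ℝ)..A, crossingFluxDeriv a θ :=
    intervalIntegral.continuous_parametric_intervalIntegral_of_continuous'
      (f := fun θ a => crossingFluxDeriv a θ)
      (continuous_crossingFluxDeriv.comp continuous_swap) 0 A
  simp_rw [hpt]
  rw [intervalIntegral.integral_add (hcont.intervalIntegrable _ _) (by simp), hswap]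
  simp

/-- For every `A, α ∈ ℝ`, `σ > 0` and positive integer `J`,
`σ·∫_0^{πJ/σ} φ(A cos(σy+α))·[2φ(A sin(σy+α)) − A sin(σy+α)(2Φ(−A sin(σy+α)) − 1)] dy = J`. -/
theorem rice_cosine_crossings (A α σ : ℝ) (hσ : 0 < σ) (J : ℕ) (hJ : 1 ≤ J) :
    σ * ∫ y in Set.Icc (0 : ℝ) (Real.pi * J / σ),
        gaussPDF (A * Real.cos (σ * y + α)) *
          (2 * gaussPDF (A * Real.sin (σ * y + α)) -
            A * Real.sin (σ * y + α) *
              (2 * gaussCDF (-(A * Real.sin (σ * y + α))) - 1)) = J := by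
  have hlen : (0 : ℝ) ≤ π * J / σ := by positivity
  rw [integral_Icc_eq_integral_Ioc, ← intervalIntegral.integral_of_le hlen]
  have h := intervalIntegral.mul_integral_comp_mul_add (a := 0) (b := π * J / σ)
    (f := fun θ => gaussPDF (A * cos θ) *
      (2 * gaussPDF (A * sin θ) - A * sin θ * (2 * gaussCDF (-(A * sin θ)) - 1))) σ α
  rw [show σ * 0 + α = α by ring, show σ * (π * J / σ) + α = α + J * π by field_simp; ring] at h
  exact h.trans (integral_crossing_density A α J)
end
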